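/- arXiv:1409.5174 — 2 statements merged into one kernel-verified Lean document; each statement's English description precedes it below -/
import Mathlib

section
/- For a smooth scalar function f on ℝ³ decaying suitably at infinity and any s ∈ [−1/2, 5/6], ‖f‖_{Ḣ^s} ≲ ‖f_{3/4}‖_{L²}^{5/6 − s} ‖∇ f_{3/4}‖_{L²}^{1/2 + s}, where f_{3/4} = (f/|f|)|f|^{3/4}. -/
open MeasureTheory Real FourierTransform Filter Topology ENNReal NNReal
noncomputable section

/-- `ℝ³` as a Euclidean space. -/
abbrev V3 : Type := EuclideanSpace ℝ (Fin 3)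

/-- `i`-th partial derivative of a real-valued function on `ℝ³`. -/
def pd (i : Fin 3) (f : V3 → ℝ) : V3 → ℝ :=
  fun x => fderiv ℝ f x (EuclideanSpace.single i 1)

/-- `i`-th partial derivative of a complex-valued function on `ℝ³`. -/
def pdC (i : Fin 3) (f : V3 → ℂ) : V3 → ℂ :=
  fun x => fderiv ℝ f x (EuclideanSpace.single i 1)

/-- Magnitude of the horizontal frequency `|ξ_h|`, `ξ_h = (ξ₁, ξ₂, 0)`. -/
def xih (ξ : V3) : ℝ := Real.sqrt ((ξ 0) ^ 2 + (ξ 1) ^ 2)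

/-- Squared anisotropic homogeneous Sobolev norm:
`‖f‖²_{Ḣ^{s,s'}} = ∫ |ξ_h|^{2s} |ξ₃|^{2s'} |f̂(ξ)|² dξ`. -/
def hssSq (s s' : ℝ) (f : V3 → ℂ) : ℝ≥0∞ :=
  ∫⁻ ξ : V3, ENNReal.ofReal (xih ξ ^ (2 * s) * |ξ 2| ^ (2 * s'))
    * (‖𝓕 f ξ‖₊ : ℝ≥0∞) ^ 2

/-- Anisotropic homogeneous Sobolev norm `‖f‖_{Ḣ^{s,s'}}`. -/
def hssNorm (s s' : ℝ) (f : V3 → ℂ) : ℝ≥0∞ := hssSq s s' f ^ (1 / 2 : ℝ)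

/-- Squared isotropic homogeneous Sobolev norm `‖f‖²_{Ḣ^s} = ∫ |ξ|^{2s}|f̂(ξ)|²dξ`. -/
def sobSq (s : ℝ) (f : V3 → ℂ) : ℝ≥0∞ :=
  ∫⁻ ξ : V3, ENNReal.ofReal (‖ξ‖ ^ (2 * s)) * (‖𝓕 f ξ‖₊ : ℝ≥0∞) ^ 2

/-- Isotropic homogeneous Sobolev norm `‖f‖_{Ḣ^s}`. -/
def sobNorm (s : ℝ) (f : V3 → ℂ) : ℝ≥0∞ := sobSq s f ^ (1 / 2 : ℝ)

/-- The signed power `f_{3/4} = sign(f)|f|^{3/4}`. -/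
def ppow (f : V3 → ℝ) : V3 → ℝ := fun x => Real.sign (f x) * |f x| ^ (3 / 4 : ℝ)

lemma aux_plancherel (h : V3 → ℂ) (h1 : Integrable h) (h2 : MemLp h 2) :
    ∫⁻ ξ, ‖𝓕 h ξ‖ₑ ^ 2 = ∫⁻ x, ‖h x‖ₑ ^ 2 := by
  have hcont : Continuous (𝓕 h) :=
    VectorFourier.fourierIntegral_continuous Real.continuous_fourierChar
      (by exact continuous_inner) h1
  set F : Lp ℂ 2 (volume : Measure V3) := 𝓕 (h2.toLp h) with hF
  have key : ∀ᵐ x ∂(volume : Measure V3), 𝓕 h x = F x := by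
    apply ae_eq_of_integral_contDiff_smul_eq (μ := volume) hcont.locallyIntegrable
    · exact (Lp.memLp F).locallyIntegrable (by norm_num)
    intro g hg hgs
    let gc : V3 → ℂ := fun x => (g x : ℂ)
    have hgc : ContDiff ℝ (⊤ : ℕ∞) gc := Complex.ofRealCLM.contDiff.comp hg
    have hgcs : HasCompactSupport gc := hgs.comp_left (g := fun t : ℝ => (t : ℂ)) (by simp)
    let φ : SchwartzMap V3 ℂ := hgcs.toSchwartzMap hgc
    have hφ : ∀ x, φ x = (g x : ℂ) := fun x => rfl
    have e1 : ∫ x, g x • 𝓕 h x = ∫ x, φ x • 𝓕 h x := by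
      simp [hφ]
    have e2 : ∫ x, g x • F x = ∫ x, φ x • F x := by
      simp [hφ]
    rw [e1, e2, ← Lp.toTemperedDistribution_apply, hF, ← Lp.fourier_toTemperedDistribution_eq,
      TemperedDistribution.fourier_apply, Lp.toTemperedDistribution_apply]
    have e3 : ∫ x, (𝓕 φ) x • (h2.toLp h) x = ∫ x, 𝓕 φ x • h x := by
      apply integral_congr_ae
      filter_upwards [h2.coeFn_toLp] with x hx
      rw [hx]
    rw [e3]
    have := VectorFourier.integral_fourierIntegral_smul_eq_flip (e := Real.fourierChar)
      (L := (innerₗ V3)) (μ := volume) (ν := volume) (f := φ) (g := h)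
      Real.continuous_fourierChar (by exact continuous_inner) φ.integrable h1
    rw [flip_innerₗ] at this
    exact this.symm
  have hn : ‖F‖ = ‖h2.toLp h‖ := Lp.norm_fourier_eq _
  have hn2 : eLpNorm F 2 = eLpNorm h 2 := by
    rw [Lp.norm_def, Lp.norm_toLp] at hn
    exact (ENNReal.toReal_eq_toReal_iff' (Lp.eLpNorm_ne_top F) h2.2.ne).1 hn
  have hn3 : eLpNorm (𝓕 h) 2 = eLpNorm h 2 := by
    rw [← hn2]; exact eLpNorm_congr_ae key
  rw [eLpNorm_eq_lintegral_rpow_enorm_toReal (by norm_num) (by norm_num),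
    eLpNorm_eq_lintegral_rpow_enorm_toReal (by norm_num) (by norm_num)] at hn3
  have := ENNReal.rpow_left_injective (x := 1 / (2:ℝ≥0∞).toReal) (by norm_num) hn3
  simpa using this

lemma aux_lint_Ioi (a c : ℝ) (ha : 0 < a) (hc : c < -1) :
    ∫⁻ r in Set.Ioi a, ENNReal.ofReal (r ^ c) = ENNReal.ofReal (a ^ (c + 1) / (-c - 1)) := by
  rw [← ofReal_integral_eq_lintegral_ofReal (integrableOn_Ioi_rpow_of_lt hc ha),
    integral_Ioi_rpow_of_lt hc ha]
  · congr 1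
    rw [neg_div, ← div_neg]; congr 1; ring
  · filter_upwards [ae_restrict_mem measurableSet_Ioi] with r hr
    exact Real.rpow_nonneg (ha.le.trans (le_of_lt hr)) _

lemma aux_lint_Ioc (a c : ℝ) (ha : 0 ≤ a) (hc : -1 < c) :
    ∫⁻ r in Set.Ioc 0 a, ENNReal.ofReal (r ^ c) = ENNReal.ofReal (a ^ (c + 1) / (c + 1)) := by
  have hi := (intervalIntegral.intervalIntegrable_rpow' (a := 0) (b := a) hc)
  rw [intervalIntegrable_iff_integrableOn_Ioc_of_le ha] at hi
  rw [← ofReal_integral_eq_lintegral_ofReal hi, ← intervalIntegral.integral_of_le ha,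
    integral_rpow (Or.inl hc), Real.zero_rpow (by linarith), sub_zero]
  filter_upwards [ae_restrict_mem measurableSet_Ioc] with r hr
  exact Real.rpow_nonneg hr.1.le _

lemma aux_tonelli (k : ℝ → ℝ≥0∞) (hk : Measurable k) (g : V3 → ℝ≥0∞) (hg : Measurable g)
    (T : Set (ℝ × V3)) (hT : MeasurableSet T) :
    ∫⁻ r in Set.Ioi (0:ℝ), k r * ∫⁻ x in {x | (r, x) ∈ T}, g x
      = ∫⁻ x, g x * ∫⁻ r in {r | (r, x) ∈ T} ∩ Set.Ioi 0, k r := by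
  have m1 : ∀ r, MeasurableSet {x | (r, x) ∈ T} := fun r => measurable_prodMk_left hT
  have m2 : ∀ x, MeasurableSet {r | (r, x) ∈ T} := fun x => measurable_prodMk_right hT
  have e1 : ∀ r, k r * ∫⁻ x in {x | (r, x) ∈ T}, g x
      = ∫⁻ x, T.indicator (fun z => k z.1 * g z.2) (r, x) := by
    intro r
    rw [← lintegral_indicator (m1 r), ← lintegral_const_mul _ (hg.indicator (m1 r))]
    refine lintegral_congr fun x => ?_
    by_cases hx : (r, x) ∈ T <;> simp [Set.indicator, hx]
  have e2 : ∀ x, g x * ∫⁻ r in {r | (r, x) ∈ T} ∩ Set.Ioi 0, k r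
      = ∫⁻ r in Set.Ioi (0:ℝ), T.indicator (fun z => k z.1 * g z.2) (r, x) := by
    intro x
    rw [← Measure.restrict_restrict (m2 x), ← lintegral_indicator (m2 x),
      ← lintegral_const_mul _ (hk.indicator (m2 x))]
    refine lintegral_congr fun r => ?_
    by_cases hx : (r, x) ∈ T <;> simp [Set.indicator, hx, mul_comm]
  simp_rw [e1, e2]
  rw [lintegral_lintegral_swap]
  apply Measurable.aemeasurable
  have : Measurable (T.indicator (fun z : ℝ × V3 => k z.1 * g z.2)) := by
    apply Measurable.indicator _ hT
    fun_prop
  exact this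

lemma aux_fourier_le (h : V3 → ℂ) (ξ : V3) : ‖𝓕 h ξ‖ₑ ≤ ∫⁻ x, ‖h x‖ₑ := by
  rw [Real.fourier_eq]
  refine (enorm_integral_le_lintegral_enorm _).trans (le_of_eq ?_)
  refine lintegral_congr fun x => ?_
  rw [← ofReal_norm, ← ofReal_norm, Circle.norm_smul]

lemma aux_fourier_cont (h : V3 → ℂ) (h1 : Integrable h) : Continuous (𝓕 h) :=
    VectorFourier.fourierIntegral_continuous Real.continuous_fourierChar
      (by exact continuous_inner) h1

lemma aux_ball (h : V3 → ℂ) (h1 : Integrable h) (h2 : MemLp h 2) (S : Set V3)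
    (hS : MeasurableSet S) (r : ℝ) (hr : 0 < r) :
    ∫⁻ ξ in Metric.ball (0:V3) r, ‖𝓕 h ξ‖ₑ ^ 2
      ≤ 2 * (volume (Metric.ball (0:V3) 1) * ENNReal.ofReal (r ^ 3) * (∫⁻ x in S, ‖h x‖ₑ) ^ 2)
        + 2 * ∫⁻ x in Sᶜ, ‖h x‖ₑ ^ 2 := by
  have i1 : Integrable (S.indicator h) := h1.indicator hS
  have i2 : Integrable (Sᶜ.indicator h) := h1.indicator hS.compl
  have hsum : ∀ ξ, 𝓕 h ξ = 𝓕 (S.indicator h) ξ + 𝓕 (Sᶜ.indicator h) ξ := by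
    intro ξ
    have : h = S.indicator h + Sᶜ.indicator h := (Set.indicator_self_add_compl S h).symm
    conv_lhs => rw [this]
    exact congrFun (VectorFourier.fourierIntegral_add Real.continuous_fourierChar
      (by exact continuous_inner) i1 i2) ξ
  have c2 := aux_fourier_cont _ i2
  have hpt : ∀ ξ, ‖𝓕 h ξ‖ₑ ^ 2 ≤ 2 * (∫⁻ x in S, ‖h x‖ₑ) ^ 2 + 2 * ‖𝓕 (Sᶜ.indicator h) ξ‖ₑ ^ 2 := by
    intro ξ
    have hb : ‖𝓕 (S.indicator h) ξ‖ₑ ≤ ∫⁻ x in S, ‖h x‖ₑ := by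
      refine (aux_fourier_le _ ξ).trans (le_of_eq ?_)
      rw [← lintegral_indicator hS]
      refine lintegral_congr fun x => ?_
      rw [enorm_indicator_eq_indicator_enorm]
    rw [hsum ξ]
    calc _ ≤ (‖𝓕 (S.indicator h) ξ‖ₑ + ‖𝓕 (Sᶜ.indicator h) ξ‖ₑ) ^ 2 := by
            gcongr; exact enorm_add_le _ _
      _ ≤ 2 * ‖𝓕 (S.indicator h) ξ‖ₑ ^ 2 + 2 * ‖𝓕 (Sᶜ.indicator h) ξ‖ₑ ^ 2 := by
            have hx : ‖𝓕 (S.indicator h) ξ‖ₑ = (‖𝓕 (S.indicator h) ξ‖₊ : ℝ≥0∞) := rfl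
            have hy : ‖𝓕 (Sᶜ.indicator h) ξ‖ₑ = (‖𝓕 (Sᶜ.indicator h) ξ‖₊ : ℝ≥0∞) := rfl
            rw [hx, hy]
            norm_cast
            rw [← mul_add]
            exact add_sq_le
      _ ≤ _ := by gcongr
  calc _ ≤ ∫⁻ ξ in Metric.ball (0:V3) r,
        (2 * (∫⁻ x in S, ‖h x‖ₑ) ^ 2 + 2 * ‖𝓕 (Sᶜ.indicator h) ξ‖ₑ ^ 2) := by
          gcongr with ξ; exact hpt ξ
    _ = 2 * (∫⁻ x in S, ‖h x‖ₑ) ^ 2 * volume (Metric.ball (0:V3) r)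
        + 2 * ∫⁻ ξ in Metric.ball (0:V3) r, ‖𝓕 (Sᶜ.indicator h) ξ‖ₑ ^ 2 := by
          rw [lintegral_add_left measurable_const, setLIntegral_const,
            lintegral_const_mul]
          exact (c2.enorm.measurable.pow_const 2)
    _ ≤ 2 * (∫⁻ x in S, ‖h x‖ₑ) ^ 2 * volume (Metric.ball (0:V3) r)
        + 2 * ∫⁻ ξ, ‖𝓕 (Sᶜ.indicator h) ξ‖ₑ ^ 2 := by
          gcongr
          exact Measure.restrict_le_self
    _ = _ := by
          rw [aux_plancherel _ i2 (h2.indicator hS.compl), Measure.addHaar_ball_of_pos _ _ hr,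
            ← lintegral_indicator hS.compl]
          congr 1
          · simp only [finrank_euclideanSpace, Fintype.card_fin]; ring
          · congr 1
            refine lintegral_congr fun x => ?_
            by_cases hx : x ∈ S <;> simp [hx]

lemma aux_hls_core (b : ℝ) (hb1 : 3 / 2 < b) (hb2 : b < 3) (h : V3 → ℂ) (hc : Continuous h)
    (h1 : Integrable h) (h2 : MemLp h 2) (N : ℝ) (hN : 0 < N) (ρ : V3 → ℝ) (hρm : Measurable ρ)
    (hρ0 : ∀ x, 0 ≤ ρ x) (hh : ∀ x, ‖h x‖ = N * ρ x ^ b)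
    (h3 : ∫⁻ x, ENNReal.ofReal (ρ x ^ (3:ℝ)) ≤ 1) :
    ∫⁻ ξ, ENNReal.ofReal (‖ξ‖ ^ (3 - 2 * b)) * ‖𝓕 h ξ‖ₑ ^ 2
      ≤ ENNReal.ofReal (2 * b - 3) * (2 * volume (Metric.ball (0:V3) 1) * ENNReal.ofReal (1 / (3 - b))
        + 2 * ENNReal.ofReal (1 / (2 * b - 3))) * ENNReal.ofReal (N ^ 2) := by
  have hen : ∀ x, ‖h x‖ₑ = ENNReal.ofReal (N * ρ x ^ b) := fun x => by rw [← ofReal_norm, hh]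
  have hFc := aux_fourier_cont h h1
  set w : ℝ → ℝ≥0∞ := fun r => ENNReal.ofReal (r ^ (2 - 2 * b)) with hw
  have hwm : Measurable w := by fun_prop
  have s1 : ∫⁻ ξ, ENNReal.ofReal (‖ξ‖ ^ (3 - 2 * b)) * ‖𝓕 h ξ‖ₑ ^ 2
      ≤ ENNReal.ofReal (2 * b - 3) *
        ∫⁻ r in Set.Ioi (0:ℝ), w r * ∫⁻ ξ in Metric.ball (0:V3) r, ‖𝓕 h ξ‖ₑ ^ 2 := by
    have hT : MeasurableSet {z : ℝ × V3 | ‖z.2‖ < z.1} :=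
      measurableSet_lt (by fun_prop) (by fun_prop)
    have := aux_tonelli w hwm (fun ξ => ‖𝓕 h ξ‖ₑ ^ 2) (hFc.enorm.measurable.pow_const 2) _ hT
    have hball : ∀ r : ℝ, {x : V3 | (r, x) ∈ {z : ℝ × V3 | ‖z.2‖ < z.1}} = Metric.ball 0 r := by
      intro r; ext x; simp
    simp only [hball] at this
    rw [this, ← lintegral_const_mul']
    swap
    · exact ENNReal.ofReal_ne_top
    refine lintegral_mono fun ξ => ?_
    simp only
    rw [← mul_assoc, mul_comm (ENNReal.ofReal (2 * b - 3)), mul_assoc, mul_comm]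
    gcongr
    rcases (norm_nonneg ξ).eq_or_lt with h0 | h0
    · rw [← h0, Real.zero_rpow (by linarith)]; simp
    have hs : {r : ℝ | (r, ξ) ∈ {z : ℝ × V3 | ‖z.2‖ < z.1}} ∩ Set.Ioi 0 = Set.Ioi ‖ξ‖ := by
      ext r
      simp only [Set.mem_ofPred_eq, Set.mem_inter_iff, Set.mem_Ioi]
      exact ⟨fun q => q.1, fun q => ⟨q, h0.trans q⟩⟩
    rw [hs, aux_lint_Ioi _ _ h0 (by linarith), ← ENNReal.ofReal_mul (by linarith)]
    apply le_of_eq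
    congr 1
    rw [show 2 - 2 * b + 1 = 3 - 2 * b by ring, show -(2 - 2 * b) - 1 = 2 * b - 3 by ring]
    field_simp
    rw [div_self (by linarith)]
  set S : ℝ → Set V3 := fun r => {x | r ≤ ρ x} with hSdef
  have hS : ∀ r, MeasurableSet (S r) := fun r => measurableSet_le measurable_const hρm
  have hSc : ∀ r, (S r)ᶜ = {x | ρ x < r} := by intro r; ext x; simp [hSdef]
  have hJ : ∀ r, 0 < r → ∫⁻ x in S r, ‖h x‖ₑ ≤ ENNReal.ofReal (N * r ^ (b - 3)) := by
    intro r hr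
    calc ∫⁻ x in S r, ‖h x‖ₑ
        ≤ ∫⁻ x in S r, ENNReal.ofReal (N * r ^ (b - 3)) * ENNReal.ofReal (ρ x ^ (3:ℝ)) := by
          apply setLIntegral_mono' (hS r)
          intro x hx
          have hx' : r ≤ ρ x := hx
          have hp : 0 < ρ x := hr.trans_le hx'
          rw [hen, ← ENNReal.ofReal_mul (by positivity)]
          apply ENNReal.ofReal_le_ofReal
          rw [mul_assoc]
          gcongr
          calc ρ x ^ b = ρ x ^ (b - 3) * ρ x ^ (3:ℝ) := by
                rw [← Real.rpow_add hp]; congr 1; ring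
            _ ≤ r ^ (b - 3) * ρ x ^ (3:ℝ) := by
                gcongr ?_ * _
                exact Real.rpow_le_rpow_of_nonpos hr hx' (by linarith)
      _ ≤ ∫⁻ x, ENNReal.ofReal (N * r ^ (b - 3)) * ENNReal.ofReal (ρ x ^ (3:ℝ)) := by
          exact lintegral_mono' Measure.restrict_le_self le_rfl
      _ ≤ ENNReal.ofReal (N * r ^ (b - 3)) * 1 := by
          rw [lintegral_const_mul' _ _ ENNReal.ofReal_ne_top]
          gcongr
      _ = _ := mul_one _
  have s2 : ∀ r ∈ Set.Ioi (0:ℝ), w r * ∫⁻ ξ in Metric.ball (0:V3) r, ‖𝓕 h ξ‖ₑ ^ 2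
      ≤ 2 * volume (Metric.ball (0:V3) 1) * ENNReal.ofReal N *
          (ENNReal.ofReal (r ^ (2 - b)) * ∫⁻ x in S r, ‖h x‖ₑ)
        + 2 * (w r * ∫⁻ x in (S r)ᶜ, ‖h x‖ₑ ^ 2) := by
    intro r hr
    have hr : 0 < r := hr
    calc _ ≤ w r * (2 * (volume (Metric.ball (0:V3) 1) * ENNReal.ofReal (r ^ 3) *
            (∫⁻ x in S r, ‖h x‖ₑ) ^ 2) + 2 * ∫⁻ x in (S r)ᶜ, ‖h x‖ₑ ^ 2) := by
          gcongr
          exact aux_ball h h1 h2 (S r) (hS r) r hr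
      _ = 2 * volume (Metric.ball (0:V3) 1) * ((w r * ENNReal.ofReal (r ^ 3) *
            (∫⁻ x in S r, ‖h x‖ₑ)) * (∫⁻ x in S r, ‖h x‖ₑ)) +
            2 * (w r * ∫⁻ x in (S r)ᶜ, ‖h x‖ₑ ^ 2) := by ring
      _ ≤ 2 * volume (Metric.ball (0:V3) 1) * ((w r * ENNReal.ofReal (r ^ 3) *
            ENNReal.ofReal (N * r ^ (b - 3))) * (∫⁻ x in S r, ‖h x‖ₑ)) +
            2 * (w r * ∫⁻ x in (S r)ᶜ, ‖h x‖ₑ ^ 2) := by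
          gcongr
          exact hJ r hr
      _ = _ := by
          have : w r * ENNReal.ofReal (r ^ 3) * ENNReal.ofReal (N * r ^ (b - 3))
              = ENNReal.ofReal N * ENNReal.ofReal (r ^ (2 - b)) := by
            rw [hw]
            simp only
            rw [← ENNReal.ofReal_mul (by positivity), ← ENNReal.ofReal_mul (by positivity),
              ← ENNReal.ofReal_mul (by positivity)]
            congr 1
            rw [show 2 - b = (2 - 2 * b) + (3 : ℕ) + (b - 3) by push_cast; ring,
              Real.rpow_add hr, Real.rpow_add hr, Real.rpow_natCast]
            ring
          rw [this]; ring
  have t1 : ∫⁻ r in Set.Ioi (0:ℝ), ENNReal.ofReal (r ^ (2 - b)) * ∫⁻ x in S r, ‖h x‖ₑ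
      ≤ ENNReal.ofReal (N * (1 / (3 - b))) := by
    have hT : MeasurableSet {z : ℝ × V3 | z.1 ≤ ρ z.2} :=
      measurableSet_le (by fun_prop) (by fun_prop)
    have := aux_tonelli (fun r => ENNReal.ofReal (r ^ (2 - b))) (by fun_prop)
      (fun x => ‖h x‖ₑ) hc.enorm.measurable _ hT
    refine this.le.trans ?_
    calc _ = ∫⁻ x, ENNReal.ofReal (N * (1 / (3 - b))) * ENNReal.ofReal (ρ x ^ (3:ℝ)) := by
          refine lintegral_congr fun x => ?_
          have hs : {r : ℝ | (r, x) ∈ {z : ℝ × V3 | z.1 ≤ ρ z.2}} ∩ Set.Ioi 0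
              = Set.Ioc 0 (ρ x) := by
            ext r; simp [and_comm]
          have h3b : 0 < 3 - b := by linarith
          have := hρ0 x
          rw [hs, aux_lint_Ioc _ _ (hρ0 x) (by linarith), hen,
            ← ENNReal.ofReal_mul (by positivity), ← ENNReal.ofReal_mul (by positivity)]
          congr 1
          have e3 : ρ x ^ (3:ℝ) = ρ x ^ b * ρ x ^ (2 - b + 1) := by
            rw [← Real.rpow_add_of_nonneg this (by linarith) (by linarith)]
            congr 1; ring
          rw [e3, show 2 - b + 1 = 3 - b by ring]
          ring
      _ ≤ ENNReal.ofReal (N * (1 / (3 - b))) * 1 := by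
          rw [lintegral_const_mul' _ _ ENNReal.ofReal_ne_top]
          gcongr
      _ = _ := mul_one _
  have t2 : ∫⁻ r in Set.Ioi (0:ℝ), w r * ∫⁻ x in (S r)ᶜ, ‖h x‖ₑ ^ 2
      ≤ ENNReal.ofReal (N ^ 2 * (1 / (2 * b - 3))) := by
    have hT : MeasurableSet {z : ℝ × V3 | ρ z.2 < z.1} :=
      measurableSet_lt (by fun_prop) (by fun_prop)
    have := aux_tonelli w hwm
      (fun x => ‖h x‖ₑ ^ 2) (hc.enorm.measurable.pow_const 2) _ hT
    simp only [hSc]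
    refine this.le.trans ?_
    calc _ ≤ ∫⁻ x, ENNReal.ofReal (N ^ 2 * (1 / (2 * b - 3))) * ENNReal.ofReal (ρ x ^ (3:ℝ)) := by
          refine lintegral_mono fun x => ?_
          simp only
          rcases (hρ0 x).eq_or_lt with h0 | h0
          · rw [hen, ← h0, Real.zero_rpow (by linarith)]; simp
          have hs : {r : ℝ | (r, x) ∈ {z : ℝ × V3 | ρ z.2 < z.1}} ∩ Set.Ioi 0
              = Set.Ioi (ρ x) := by
            ext r
            simp only [Set.mem_ofPred_eq, Set.mem_inter_iff, Set.mem_Ioi]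
            exact ⟨fun q => q.1, fun q => ⟨q, h0.trans q⟩⟩
          have h3b : 0 < 2 * b - 3 := by linarith
          rw [hs, aux_lint_Ioi _ _ h0 (by linarith), hen,
            ← ENNReal.ofReal_pow (by positivity), ← ENNReal.ofReal_mul (by positivity),
            ← ENNReal.ofReal_mul (by positivity)]
          apply le_of_eq
          congr 1
          have e3 : ρ x ^ (3:ℝ) = ρ x ^ b * ρ x ^ b * ρ x ^ (2 - 2 * b + 1) := by
            rw [← Real.rpow_add h0, ← Real.rpow_add h0]
            congr 1; ring
          rw [e3, show -(2 - 2 * b) - 1 = 2 * b - 3 by ring]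
          ring
      _ ≤ ENNReal.ofReal (N ^ 2 * (1 / (2 * b - 3))) * 1 := by
          rw [lintegral_const_mul' _ _ ENNReal.ofReal_ne_top]
          gcongr
      _ = _ := mul_one _
  refine s1.trans ?_
  rw [mul_assoc]
  gcongr
  have mJ : Measurable fun r => ENNReal.ofReal (r ^ (2 - b)) * ∫⁻ x in S r, ‖h x‖ₑ := by
    apply Measurable.mul (by fun_prop)
    have : (fun r => ∫⁻ x in S r, ‖h x‖ₑ) = fun r => ∫⁻ x,
        ({z : ℝ × V3 | z.1 ≤ ρ z.2}.indicator (fun z => ‖h z.2‖ₑ)) (r, x) := by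
      funext r
      rw [← lintegral_indicator (hS r)]
      refine lintegral_congr fun x => ?_
      by_cases hx : r ≤ ρ x <;> simp [Set.indicator, hSdef, hx]
    rw [this]
    apply Measurable.lintegral_prod_right'
    apply Measurable.indicator
    · exact hc.enorm.measurable.comp measurable_snd
    · exact measurableSet_le (by fun_prop) (by fun_prop)
  calc _ ≤ ∫⁻ r in Set.Ioi (0:ℝ), (2 * volume (Metric.ball (0:V3) 1) * ENNReal.ofReal N *
          (ENNReal.ofReal (r ^ (2 - b)) * ∫⁻ x in S r, ‖h x‖ₑ)
        + 2 * (w r * ∫⁻ x in (S r)ᶜ, ‖h x‖ₑ ^ 2)) := setLIntegral_mono' measurableSet_Ioi s2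
    _ = 2 * volume (Metric.ball (0:V3) 1) * ENNReal.ofReal N *
          (∫⁻ r in Set.Ioi (0:ℝ), ENNReal.ofReal (r ^ (2 - b)) * ∫⁻ x in S r, ‖h x‖ₑ)
        + 2 * ∫⁻ r in Set.Ioi (0:ℝ), (w r * ∫⁻ x in (S r)ᶜ, ‖h x‖ₑ ^ 2) := by
          rw [lintegral_add_left (mJ.const_mul _), lintegral_const_mul _ mJ,
            lintegral_const_mul' _ _ (by norm_num)]
    _ ≤ 2 * volume (Metric.ball (0:V3) 1) * ENNReal.ofReal N * ENNReal.ofReal (N * (1 / (3 - b)))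
        + 2 * ENNReal.ofReal (N ^ 2 * (1 / (2 * b - 3))) := by gcongr
    _ = _ := by
          rw [ENNReal.ofReal_mul hN.le, ENNReal.ofReal_mul (by positivity), pow_two,
            ENNReal.ofReal_mul hN.le]
          ring

lemma aux_hls (b : ℝ) (hb1 : 3 / 2 < b) (hb2 : b < 3) :
    ∃ C : ℝ≥0, ∀ h : V3 → ℂ, Continuous h → Integrable h → MemLp h 2 →
      MemLp h (ENNReal.ofReal (3 / b)) →
      ∫⁻ ξ, ENNReal.ofReal (‖ξ‖ ^ (3 - 2 * b)) * ‖𝓕 h ξ‖ₑ ^ 2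
        ≤ C * eLpNorm h (ENNReal.ofReal (3 / b)) volume ^ 2 := by
  set K : ℝ≥0∞ := ENNReal.ofReal (2 * b - 3) * (2 * volume (Metric.ball (0:V3) 1) * ENNReal.ofReal (1 / (3 - b))
        + 2 * ENNReal.ofReal (1 / (2 * b - 3))) with hK
  have hKt : K ≠ ∞ := by
    have : volume (Metric.ball (0:V3) 1) ≠ ∞ := measure_ball_lt_top.ne
    rw [hK]
    finiteness
  refine ⟨K.toNNReal, fun h hc h1 h2 hp => ?_⟩
  rw [ENNReal.coe_toNNReal hKt]
  have hb0 : 0 < b := by linarith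
  have hp0 : ENNReal.ofReal (3 / b) ≠ 0 := by
    simp only [ne_eq, ENNReal.ofReal_eq_zero, not_le]; positivity
  set N := (eLpNorm h (ENNReal.ofReal (3 / b)) volume).toReal with hNdef
  have hNe : eLpNorm h (ENNReal.ofReal (3 / b)) volume = ENNReal.ofReal N :=
    (ENNReal.ofReal_toReal hp.2.ne).symm
  rcases (show 0 ≤ N from ENNReal.toReal_nonneg).eq_or_lt with hN | hN
  · rw [← hN, ENNReal.ofReal_zero, eLpNorm_eq_zero_iff hp.1 hp0] at hNe
    have : ∀ ξ, ‖𝓕 h ξ‖ₑ = 0 := by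
      intro ξ
      refine le_antisymm ((aux_fourier_le h ξ).trans (le_of_eq ?_)) zero_le
      rw [lintegral_congr_ae (g := fun _ => 0)]
      · simp
      · filter_upwards [hNe] with x hx
        simp [hx]
    simp [this]
  rw [hNe, ← ENNReal.ofReal_pow hN.le]
  apply aux_hls_core b hb1 hb2 h hc h1 h2 N hN (fun x => (‖h x‖ / N) ^ (1 / b))
  · have := hc.norm.measurable
    fun_prop
  · intro x; positivity
  · intro x
    rw [← Real.rpow_mul (by positivity), one_div_mul_cancel hb0.ne', Real.rpow_one]
    field_simp
  · have e := hNe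
    rw [eLpNorm_eq_lintegral_rpow_enorm_toReal hp0 ENNReal.ofReal_ne_top,
      ENNReal.toReal_ofReal (by positivity)] at e
    have e2 : ∫⁻ x, ‖h x‖ₑ ^ (3 / b) = ENNReal.ofReal (N ^ (3 / b)) := by
      rw [← ENNReal.ofReal_rpow_of_pos hN, ← e, ← ENNReal.rpow_mul,
        one_div_mul_cancel (by positivity), ENNReal.rpow_one]
    calc _ = ∫⁻ x, ENNReal.ofReal ((N ^ (3 / b))⁻¹) * ‖h x‖ₑ ^ (3 / b) := by
          refine lintegral_congr fun x => ?_
          rw [← ofReal_norm, ENNReal.ofReal_rpow_of_nonneg (norm_nonneg _) (by positivity),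
            ← ENNReal.ofReal_mul (by positivity)]
          congr 1
          rw [← Real.rpow_mul (by positivity), Real.div_rpow (by positivity) hN.le]
          rw [show 1 / b * 3 = 3 / b by ring]
          ring
      _ = 1 := by
          rw [lintegral_const_mul' _ _ ENNReal.ofReal_ne_top, e2, ← ENNReal.ofReal_mul (by positivity),
            inv_mul_cancel₀ (by positivity), ENNReal.ofReal_one]
      _ ≤ 1 := le_rfl

/-- A smooth truncation of the identity, vanishing near the origin. -/
def thetaFn (t : ℝ) : ℝ := t * Real.smoothTransition (t ^ 2 - 1)

lemma thetaFn_contDiff : ContDiff ℝ (⊤ : ℕ∞) thetaFn := by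
  unfold thetaFn
  exact contDiff_id.mul (Real.smoothTransition.contDiff.comp (by fun_prop))

lemma thetaFn_eq_zero {t : ℝ} (ht : |t| ≤ 1) : thetaFn t = 0 := by
  unfold thetaFn
  rw [Real.smoothTransition.zero_of_nonpos, mul_zero]
  have := (sq_le_one_iff_abs_le_one t).2 ht
  linarith

lemma thetaFn_eq_self {t : ℝ} (ht : 2 ≤ |t|) : thetaFn t = t := by
  unfold thetaFn
  rw [Real.smoothTransition.one_of_one_le, mul_one]
  have : 2 ^ 2 ≤ |t| ^ 2 := by gcongr
  rw [sq_abs] at this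
  linarith

lemma thetaFn_abs_le (t : ℝ) : |thetaFn t| ≤ |t| := by
  unfold thetaFn
  rw [abs_mul, abs_of_nonneg (Real.smoothTransition.nonneg _)]
  exact mul_le_of_le_one_right (abs_nonneg _) (Real.smoothTransition.le_one _)

lemma thetaFn_deriv_zero : deriv thetaFn 0 = 0 := by
  have : thetaFn =ᶠ[𝓝 0] fun _ => 0 := by
    filter_upwards [Metric.ball_mem_nhds (0:ℝ) one_pos] with t ht
    apply thetaFn_eq_zero
    simpa using (mem_ball_zero_iff.1 ht).le
  rw [this.deriv_eq]; simp

lemma thetaFn_deriv_bdd : ∃ M : ℝ≥0, ∀ t, |deriv thetaFn t| ≤ M := by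
  have hc : Continuous (deriv thetaFn) := thetaFn_contDiff.continuous_deriv (by simp)
  obtain ⟨M, hM⟩ := (isCompact_Icc (a := (-2:ℝ)) (b := 2)).exists_bound_of_continuousOn
    hc.continuousOn
  refine ⟨Real.toNNReal (max M 1), fun t => ?_⟩
  rw [Real.coe_toNNReal _ (by positivity)]
  by_cases ht : t ∈ Set.Icc (-2:ℝ) 2
  · exact (hM t ht).trans (le_max_left _ _)
  · have ht' : 2 < |t| := by
      by_contra hcon
      exact ht (abs_le.1 (not_lt.1 hcon))
    have : thetaFn =ᶠ[𝓝 t] fun t => t := by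
      have : ∀ᶠ y in 𝓝 t, 2 < |y| := continuous_abs.continuousAt.eventually_const_lt ht'
      filter_upwards [this] with y hy
      exact thetaFn_eq_self hy.le
    rw [this.deriv_eq]
    simp

lemma aux_signpow {t : ℝ} (ht : t ≠ 0) :
    HasDerivAt (fun t : ℝ => Real.sign t * |t| ^ (3 / 4 : ℝ)) (3 / 4 * |t| ^ (-(1 / 4) : ℝ)) t := by
  rcases lt_or_gt_of_ne ht with h | h
  · have h1 : HasDerivAt (fun t : ℝ => -((-t) ^ (3 / 4 : ℝ))) (3 / 4 * |t| ^ (-(1 / 4) : ℝ)) t := by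
      have := ((hasDerivAt_neg t).rpow_const (p := 3 / 4) (Or.inl (by linarith))).neg
      convert! this using 1
      rw [abs_of_neg h]; norm_num
    apply h1.congr_of_eventuallyEq
    filter_upwards [Iio_mem_nhds h] with y hy
    rw [Real.sign_of_neg hy, abs_of_neg hy]; ring
  · have h1 : HasDerivAt (fun t : ℝ => t ^ (3 / 4 : ℝ)) (3 / 4 * |t| ^ (-(1 / 4) : ℝ)) t := by
      have := ((hasDerivAt_id t).rpow_const (p := 3 / 4) (Or.inl ht))
      convert! this using 1
      rw [abs_of_pos h]; norm_num
    apply h1.congr_of_eventuallyEq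
    filter_upwards [Ioi_mem_nhds h] with y hy
    rw [Real.sign_of_pos hy, abs_of_pos hy]; ring

lemma aux_fderiv_ppow (f : V3 → ℝ) (x : V3) (hf : DifferentiableAt ℝ f x) (hx : f x ≠ 0) :
    ‖fderiv ℝ f x‖ = 4 / 3 * |f x| ^ (1 / 4 : ℝ) * ‖fderiv ℝ (ppow f) x‖ := by
  have h := (aux_signpow hx).comp_hasFDerivAt x hf.hasFDerivAt
  have h' : fderiv ℝ (ppow f) x = (3 / 4 * |f x| ^ (-(1 / 4) : ℝ)) • fderiv ℝ f x := h.fderiv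
  have hp : 0 < |f x| := abs_pos.2 hx
  rw [h', norm_smul, Real.norm_of_nonneg (by positivity), ← mul_assoc]
  have : 4 / 3 * |f x| ^ (1 / 4 : ℝ) * (3 / 4 * |f x| ^ (-(1 / 4) : ℝ)) = 1 := by
    calc _ = |f x| ^ (1 / 4 : ℝ) * |f x| ^ (-(1 / 4) : ℝ) := by ring
      _ = 1 := by rw [← Real.rpow_add hp]; norm_num
  rw [this, one_mul]

/-- Truncations of `f`. -/
def truncFn (f : V3 → ℝ) (n : ℕ) (x : V3) : ℝ := thetaFn ((n + 1) * f x) / (n + 1)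

lemma truncFn_contDiff (f : V3 → ℝ) (hf : ContDiff ℝ (⊤ : ℕ∞) f) (n : ℕ) :
    ContDiff ℝ 1 (truncFn f n) := by
  unfold truncFn
  have h : ContDiff ℝ (⊤ : ℕ∞) fun x => thetaFn ((n + 1) * f x) / (n + 1) :=
    (thetaFn_contDiff.comp (contDiff_const.mul hf)).div_const _
  exact h.of_le (by exact_mod_cast le_top)

lemma truncFn_abs_le (f : V3 → ℝ) (n : ℕ) (x : V3) : |truncFn f n x| ≤ |f x| := by
  unfold truncFn
  have hn : (0:ℝ) < n + 1 := by positivity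
  rw [abs_div, abs_of_pos hn, div_le_iff₀ hn]
  refine (thetaFn_abs_le _).trans (le_of_eq ?_)
  rw [abs_mul, abs_of_pos hn, mul_comm]

lemma truncFn_tendsto (f : V3 → ℝ) (x : V3) :
    Tendsto (fun n => truncFn f n x) atTop (𝓝 (f x)) := by
  by_cases hx : f x = 0
  · have : ∀ n, truncFn f n x = 0 := fun n => by
      simp [truncFn, hx, thetaFn]
    simp [this, hx]
  · apply tendsto_const_nhds.congr'
    have hp : 0 < |f x| := abs_pos.2 hx
    obtain ⟨N, hN⟩ := exists_nat_gt (2 / |f x|)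
    filter_upwards [eventually_ge_atTop N] with n hn
    unfold truncFn
    have hn' : (N:ℝ) ≤ n := by exact_mod_cast hn
    have hn0 : (0:ℝ) < n + 1 := by positivity
    rw [thetaFn_eq_self, mul_div_cancel_left₀ _ hn0.ne']
    rw [abs_mul, abs_of_pos hn0]
    rw [div_lt_iff₀ hp] at hN
    nlinarith

lemma truncFn_compact (f : V3 → ℝ) (hf : Continuous f)
    (hz : Tendsto f (Filter.cocompact V3) (nhds 0)) (n : ℕ) :
    HasCompactSupport (truncFn f n) := by
  have hn0 : (0:ℝ) < n + 1 := by positivity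
  have := hz.eventually (Metric.ball_mem_nhds (0:ℝ) (show (0:ℝ) < 1 / (n + 1) by positivity))
  obtain ⟨K, hK, hK'⟩ := mem_cocompact.1 this
  apply HasCompactSupport.intro hK
  intro x hx
  have h2 : f x ∈ Metric.ball (0:ℝ) (1 / (n + 1)) := hK' hx
  rw [mem_ball_zero_iff, Real.norm_eq_abs, lt_div_iff₀ hn0] at h2
  unfold truncFn
  rw [thetaFn_eq_zero, zero_div]
  rw [abs_mul, abs_of_pos hn0]; linarith

lemma truncFn_fderiv (M : ℝ≥0) (hM : ∀ t, |deriv thetaFn t| ≤ M) (f : V3 → ℝ)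
    (hf : ContDiff ℝ (⊤ : ℕ∞) f) (n : ℕ) (x : V3) :
    ‖fderiv ℝ (truncFn f n) x‖ ≤ M * (4 / 3) * ‖(|f x| ^ (1 / 4 : ℝ)) • fderiv ℝ (ppow f) x‖ := by
  have hd : DifferentiableAt ℝ f x := hf.differentiable (by simp) x
  have hn0 : (0:ℝ) < n + 1 := by positivity
  have h1 : HasDerivAt thetaFn (deriv thetaFn ((n + 1) * f x)) ((n + 1) * f x) :=
    (thetaFn_contDiff.differentiable (by simp) _).hasDerivAt
  have h2 := (h1.comp_hasFDerivAt x (hd.hasFDerivAt.const_mul (n + 1 : ℝ))).mul_const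
    ((n + 1 : ℝ)⁻¹)
  have h3 : fderiv ℝ (truncFn f n) x = deriv thetaFn ((n + 1) * f x) • fderiv ℝ f x := by
    rw [show truncFn f n = fun x => thetaFn ((n + 1) * f x) * (n + 1 : ℝ)⁻¹ from rfl]
    rw [show fderiv ℝ (fun x => thetaFn ((n + 1) * f x) * (n + 1 : ℝ)⁻¹) x = _ from h2.fderiv]
    rw [smul_smul, smul_smul]
    congr 1
    field_simp
  rw [h3, norm_smul, Real.norm_eq_abs, norm_smul, Real.norm_of_nonneg (by positivity)]
  by_cases hx : f x = 0
  · rw [hx, mul_zero, thetaFn_deriv_zero]; simp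
  · rw [aux_fderiv_ppow f x hd hx]
    calc _ ≤ (M:ℝ) * (4 / 3 * |f x| ^ (1 / 4 : ℝ) * ‖fderiv ℝ (ppow f) x‖) := by
          gcongr; exact hM _
      _ = _ := by ring

lemma aux_fatou (F : ℕ → V3 → ℝ≥0∞) (G : V3 → ℝ≥0∞) (hF : ∀ n, Measurable (F n)) (B : ℝ≥0∞)
    (hlim : ∀ x, Tendsto (fun n => F n x) atTop (𝓝 (G x))) (hB : ∀ n, ∫⁻ x, F n x ≤ B) :
    ∫⁻ x, G x ≤ B := by
  calc ∫⁻ x, G x = ∫⁻ x, liminf (fun n => F n x) atTop := by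
        refine lintegral_congr fun x => (hlim x).liminf_eq.symm
    _ ≤ liminf (fun n => ∫⁻ x, F n x) atTop := lintegral_liminf_le hF
    _ ≤ B := by
        apply liminf_le_of_le (by isBoundedDefault)
        intro b hb
        obtain ⟨n, hn⟩ := hb.exists
        exact hn.trans (hB n)

lemma aux_fourier_pd (u : V3 → ℝ) (hu : ContDiff ℝ 1 u) (hs : HasCompactSupport u) (i : Fin 3)
    (ξ : V3) :
    ‖𝓕 (fun x => ((fderiv ℝ u x (EuclideanSpace.single i 1) : ℝ) : ℂ)) ξ‖
      = 2 * π * |ξ i| * ‖𝓕 (fun x => (u x : ℂ)) ξ‖ := by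
  set uc : V3 → ℂ := fun x => (u x : ℂ) with huc
  have hd : ∀ x, fderiv ℝ uc x = Complex.ofRealCLM.comp (fderiv ℝ u x) := fun x =>
    (Complex.ofRealCLM.hasFDerivAt.comp x (hu.differentiable (by simp) x).hasFDerivAt).fderiv
  have hcd : ContDiff ℝ 1 uc := Complex.ofRealCLM.contDiff.comp hu
  have hcs : HasCompactSupport uc := hs.comp_left (g := fun t : ℝ => (t : ℂ)) (by simp)
  have hi : Integrable uc := hcd.continuous.integrable_of_hasCompactSupport hcs
  have hi' : Integrable (fderiv ℝ uc) :=
    (hcd.continuous_fderiv (by simp)).integrable_of_hasCompactSupport (hcs.fderiv ℝ)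
  have e := Real.fourier_fderiv hi (hcd.differentiable (by simp)) hi'
  have e2 := Real.fourier_continuousLinearMap_apply (a := EuclideanSpace.single i (1:ℝ)) (v := ξ) hi'
  have e3 : (fun x => ((fderiv ℝ u x (EuclideanSpace.single i 1) : ℝ) : ℂ))
      = fun x => fderiv ℝ uc x (EuclideanSpace.single i 1) := by
    funext x; rw [hd]; rfl
  rw [e3, ← e2, e]
  simp only [VectorFourier.fourierSMulRight_apply]
  rw [norm_smul, norm_smul]
  have hin : (innerSL ℝ) ξ (EuclideanSpace.single i (1:ℝ)) = ξ i := by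
    rw [innerSL_apply_apply, EuclideanSpace.inner_single_right]; simp
  simp [hin, abs_of_pos Real.pi_pos]
  ring

lemma aux_sob56 : ∃ C : ℝ≥0, ∀ u : V3 → ℝ, ContDiff ℝ 1 u → HasCompactSupport u →
    ∫⁻ ξ, ENNReal.ofReal (‖ξ‖ ^ (5 / 3 : ℝ)) * ‖𝓕 (fun x => (u x : ℂ)) ξ‖ₑ ^ 2
      ≤ C * eLpNorm (fderiv ℝ u) (ENNReal.ofReal (9 / 5)) volume ^ 2 := by
  obtain ⟨C, hC⟩ := aux_hls (5 / 3) (by norm_num) (by norm_num)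
  refine ⟨3 * C, fun u hu hs => ?_⟩
  set h : Fin 3 → V3 → ℂ := fun i x => ((fderiv ℝ u x (EuclideanSpace.single i 1) : ℝ) : ℂ) with hh
  have hcd : Continuous (fderiv ℝ u) := hu.continuous_fderiv (by simp)
  have hhc : ∀ i, Continuous (h i) := fun i => by
    rw [hh]; fun_prop
  have hhs : ∀ i, HasCompactSupport (h i) := fun i =>
    (hs.fderiv ℝ).comp_left (g := fun L : V3 →L[ℝ] ℝ => ((L (EuclideanSpace.single i 1) : ℝ) : ℂ))
      (by simp)
  have hi : ∀ i, Integrable (h i) := fun i => (hhc i).integrable_of_hasCompactSupport (hhs i)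
  have hb : ∀ i, ∫⁻ ξ, ENNReal.ofReal (‖ξ‖ ^ (-(1 / 3) : ℝ)) * ‖𝓕 (h i) ξ‖ₑ ^ 2
      ≤ C * eLpNorm (fderiv ℝ u) (ENNReal.ofReal (9 / 5)) volume ^ 2 := by
    intro i
    have := hC (h i) (hhc i) (hi i) ((hhc i).memLp_of_hasCompactSupport (hhs i))
      ((hhc i).memLp_of_hasCompactSupport (hhs i))
    norm_num at this
    norm_num
    refine this.trans ?_
    gcongr
    apply eLpNorm_mono
    intro x
    simp only [hh, Complex.norm_real]
    refine (ContinuousLinearMap.le_opNorm _ _).trans ?_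
    simp
  have hpt : ∀ ξ, ENNReal.ofReal (‖ξ‖ ^ (5 / 3 : ℝ)) * ‖𝓕 (fun x => (u x : ℂ)) ξ‖ₑ ^ 2
      ≤ ∑ i, ENNReal.ofReal (‖ξ‖ ^ (-(1 / 3) : ℝ)) * ‖𝓕 (h i) ξ‖ₑ ^ 2 := by
    intro ξ
    rcases (norm_nonneg ξ).eq_or_lt with h0 | h0
    · rw [← h0, Real.zero_rpow (by norm_num)]; simp
    have e : ∀ i, ENNReal.ofReal (‖ξ‖ ^ (-(1 / 3) : ℝ)) * ‖𝓕 (h i) ξ‖ₑ ^ 2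
        = ENNReal.ofReal (‖ξ‖ ^ (-(1 / 3) : ℝ) *
          (2 * π * |ξ i| * ‖𝓕 (fun x => (u x : ℂ)) ξ‖) ^ 2) := by
      intro i
      rw [← aux_fourier_pd u hu hs i ξ, ENNReal.ofReal_mul (by positivity),
        ENNReal.ofReal_pow (by positivity), ofReal_norm]
    simp_rw [e]
    rw [← ENNReal.ofReal_sum_of_nonneg (fun i _ => by positivity), ← ofReal_norm,
      ← ENNReal.ofReal_pow (by positivity), ← ENNReal.ofReal_mul (by positivity)]
    apply ENNReal.ofReal_le_ofReal
    have hn : ‖ξ‖ ^ 2 = ∑ i, |ξ i| ^ 2 := by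
      rw [EuclideanSpace.norm_sq_eq]; rfl
    have hk : ‖ξ‖ ^ (5 / 3 : ℝ) = ‖ξ‖ ^ (-(1 / 3) : ℝ) * ‖ξ‖ ^ 2 := by
      rw [← Real.rpow_natCast, ← Real.rpow_add h0]; norm_num
    have hs' : ∑ i, ‖ξ‖ ^ (-(1 / 3) : ℝ) * (2 * π * |ξ i| * ‖𝓕 (fun x => (u x : ℂ)) ξ‖) ^ 2
        = ‖ξ‖ ^ (-(1 / 3) : ℝ) * ‖ξ‖ ^ 2 * ‖𝓕 (fun x => (u x : ℂ)) ξ‖ ^ 2 * (2 * π) ^ 2 := by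
      rw [hn, Finset.mul_sum, Finset.sum_mul, Finset.sum_mul]
      refine Finset.sum_congr rfl fun i _ => by ring
    rw [hs', hk]
    apply le_mul_of_one_le_right (by positivity)
    nlinarith [Real.pi_gt_three]
  calc _ ≤ ∫⁻ ξ, ∑ i, ENNReal.ofReal (‖ξ‖ ^ (-(1 / 3) : ℝ)) * ‖𝓕 (h i) ξ‖ₑ ^ 2 :=
        lintegral_mono hpt
    _ = ∑ i, ∫⁻ ξ, ENNReal.ofReal (‖ξ‖ ^ (-(1 / 3) : ℝ)) * ‖𝓕 (h i) ξ‖ₑ ^ 2 := by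
        rw [lintegral_finsetSum]
        intro i _
        have := (aux_fourier_cont _ (hi i)).enorm.measurable
        fun_prop
    _ ≤ ∑ i : Fin 3, C * eLpNorm (fderiv ℝ u) (ENNReal.ofReal (9 / 5)) volume ^ 2 :=
        Finset.sum_le_sum fun i _ => hb i
    _ = _ := by
        rw [Finset.sum_const]
        simp
        ring

lemma aux_grad (f : V3 → ℝ) (hf : ContDiff ℝ (⊤ : ℕ∞) f) (n : ℕ) (M : ℝ≥0)
    (hM : ∀ t, |deriv thetaFn t| ≤ M) :
    eLpNorm (fderiv ℝ (truncFn f n)) (ENNReal.ofReal (9 / 5)) volume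
      ≤ (M * (4 / 3) : ℝ≥0) * (eLpNorm f (ENNReal.ofReal (9 / 2)) volume ^ (1 / 4 : ℝ) *
        eLpNorm (fderiv ℝ (ppow f)) 2 volume) := by
  have hfc := hf.continuous
  set φ : V3 → ℝ := fun x => ‖f x‖ ^ (1 / 4 : ℝ) with hφ
  have hφm : Measurable φ := by have := hfc.norm.measurable; fun_prop
  have hG : AEStronglyMeasurable (fderiv ℝ (ppow f)) volume :=
    (measurable_fderiv ℝ (ppow f)).aestronglyMeasurable
  have : ENNReal.HolderTriple 18 2 (ENNReal.ofReal (9 / 5)) := by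
    constructor
    rw [show (18:ℝ≥0∞) = ENNReal.ofReal 18 by norm_num, show (2:ℝ≥0∞) = ENNReal.ofReal 2 by norm_num,
      ← ENNReal.ofReal_inv_of_pos (by norm_num), ← ENNReal.ofReal_inv_of_pos (by norm_num),
      ← ENNReal.ofReal_inv_of_pos (by norm_num), ← ENNReal.ofReal_add (by norm_num) (by norm_num)]
    norm_num
  have h1 := eLpNorm_smul_le_mul_eLpNorm (p := 18) (q := 2) (r := ENNReal.ofReal (9 / 5))
    (f := fderiv ℝ (ppow f)) (φ := φ) hG hφm.aestronglyMeasurable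
  have h2 : eLpNorm φ 18 volume = eLpNorm f (ENNReal.ofReal (9 / 2)) volume ^ (1 / 4 : ℝ) := by
    rw [hφ, eLpNorm_norm_rpow _ (by norm_num), show (18:ℝ≥0∞) = ENNReal.ofReal 18 by norm_num,
      ← ENNReal.ofReal_mul (by norm_num)]
    norm_num
  rw [h2] at h1
  refine le_trans ?_ (mul_le_mul_right h1 _)
  have := eLpNorm_le_nnreal_smul_eLpNorm_of_ae_le_mul (f := fderiv ℝ (truncFn f n))
    (g := φ • fderiv ℝ (ppow f)) (c := M * (4 / 3)) (μ := volume)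
    (Eventually.of_forall fun x => by
      have := truncFn_fderiv M hM f hf n x
      rw [← NNReal.coe_le_coe]
      push_cast
      exact this) (ENNReal.ofReal (9 / 5))
  exact this

lemma aux_A (M : ℝ≥0) (hM : ∀ t, |deriv thetaFn t| ≤ M) :
    ∃ C : ℝ≥0, ∀ f : V3 → ℝ, ContDiff ℝ (⊤ : ℕ∞) f → Tendsto f (Filter.cocompact V3) (nhds 0) →
      MemLp f (ENNReal.ofReal (9 / 2)) →
      eLpNorm f (ENNReal.ofReal (9 / 2)) volume ^ (3 / 4 : ℝ)
        ≤ C * eLpNorm (fderiv ℝ (ppow f)) 2 volume := by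
  set K : ℝ≥0 := SNormLESNormFDerivOfEqConst ℝ (volume : Measure V3) (Real.toNNReal (9 / 5))
  refine ⟨K * (M * (4 / 3)), fun f hf hz hL => ?_⟩
  have hgns : ∀ n, eLpNorm (truncFn f n) (ENNReal.ofReal (9 / 2)) volume
      ≤ K * eLpNorm (fderiv ℝ (truncFn f n)) (ENNReal.ofReal (9 / 5)) volume := by
    intro n
    have := eLpNorm_le_eLpNorm_fderiv_of_eq (volume : Measure V3) (truncFn_contDiff f hf n)
      (truncFn_compact f hf.continuous hz n) (p := Real.toNNReal (9 / 5))
      (p' := Real.toNNReal (9 / 2)) (by rw [Real.one_le_toNNReal]; norm_num)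
      (by simp) (by
        rw [finrank_euclideanSpace, NNReal.coe_inv, Real.coe_toNNReal _ (by norm_num),
          Real.coe_toNNReal _ (by norm_num)]
        norm_num)
    exact this
  set A := eLpNorm f (ENNReal.ofReal (9 / 2)) volume with hA
  set D := eLpNorm (fderiv ℝ (ppow f)) 2 volume with hD
  have h1 : A ≤ (K * (M * (4 / 3)) : ℝ≥0) * D * A ^ (1 / 4 : ℝ) := by
    have hlim := Lp.eLpNorm_lim_le_liminf_eLpNorm (p := ENNReal.ofReal (9 / 2)) (μ := volume)
      (f := truncFn f) (fun n => (truncFn_contDiff f hf n).continuous.aestronglyMeasurable) f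
      (Eventually.of_forall fun x => truncFn_tendsto f x)
    refine hlim.trans ?_
    apply liminf_le_of_le (by isBoundedDefault)
    intro b hb
    obtain ⟨n, hn⟩ := hb.exists
    refine hn.trans ((hgns n).trans ?_)
    calc _ ≤ (K:ℝ≥0∞) * ((M * (4 / 3) : ℝ≥0) * (A ^ (1 / 4 : ℝ) * D)) := by
          gcongr
          exact aux_grad f hf n M hM
      _ = _ := by push_cast; ring
  have hAt : A ≠ ∞ := hL.2.ne
  by_cases hA0 : A = 0
  · rw [hA0, ENNReal.zero_rpow_of_pos (by norm_num)]; exact zero_le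
  have hq0 : A ^ (1 / 4 : ℝ) ≠ 0 := by
    simp [ENNReal.rpow_eq_zero_iff, hA0, hAt]
  have hqt : A ^ (1 / 4 : ℝ) ≠ ∞ := ENNReal.rpow_ne_top_of_nonneg (by norm_num) hAt
  have hsplit : A = A ^ (3 / 4 : ℝ) * A ^ (1 / 4 : ℝ) := by
    rw [← ENNReal.rpow_add _ _ hA0 hAt]; norm_num
  rw [← ENNReal.mul_le_mul_iff_left hq0 hqt, ← hsplit]
  exact h1

lemma aux_bdd (f : V3 → ℝ) (hf : Continuous f)
    (hz : Tendsto f (Filter.cocompact V3) (nhds 0)) : ∃ B : ℝ, ∀ x, ‖f x‖ ≤ B := by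
  let g : ZeroAtInftyContinuousMap V3 ℝ := ⟨⟨f, hf⟩, hz⟩
  exact ⟨‖g.toBCF‖, fun x => g.toBCF.norm_coe_le_norm x⟩

lemma aux_memLp (f : V3 → ℝ) (hf : Continuous f) (hi : Integrable f) (B : ℝ)
    (hB : ∀ x, ‖f x‖ ≤ B) (p : ℝ) (hp : 1 ≤ p) : MemLp f (ENNReal.ofReal p) := by
  refine ⟨hf.aestronglyMeasurable, ?_⟩
  have hB0 : 0 ≤ B := (norm_nonneg _).trans (hB 0)
  have hp0 : ENNReal.ofReal p ≠ 0 := by simp; linarith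
  rw [eLpNorm_lt_top_iff_lintegral_rpow_enorm_lt_top hp0 ENNReal.ofReal_ne_top,
    ENNReal.toReal_ofReal (by linarith)]
  calc ∫⁻ x, ‖f x‖ₑ ^ p ≤ ∫⁻ x, ENNReal.ofReal (B ^ (p - 1)) * ‖f x‖ₑ := by
        refine lintegral_mono fun x => ?_
        simp only
        rw [← ofReal_norm, ENNReal.ofReal_rpow_of_nonneg (norm_nonneg _) (by linarith),
          ← ENNReal.ofReal_mul (by positivity)]
        apply ENNReal.ofReal_le_ofReal
        calc ‖f x‖ ^ p = ‖f x‖ ^ (p - 1) * ‖f x‖ ^ (1:ℝ) := by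
              rw [← Real.rpow_add_of_nonneg (norm_nonneg _) (by linarith) (by linarith)]
              congr 1; ring
          _ ≤ B ^ (p - 1) * ‖f x‖ := by
              rw [Real.rpow_one]
              gcongr
              exact hB x
    _ = ENNReal.ofReal (B ^ (p - 1)) * ∫⁻ x, ‖f x‖ₑ :=
        lintegral_const_mul' _ _ ENNReal.ofReal_ne_top
    _ < ∞ := ENNReal.mul_lt_top ENNReal.ofReal_lt_top hi.2

lemma aux_fourier_tendsto (f : V3 → ℝ) (hf : ContDiff ℝ (⊤ : ℕ∞) f) (hi : Integrable f) (ξ : V3) :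
    Tendsto (fun n => 𝓕 (fun x => (truncFn f n x : ℂ)) ξ) atTop (𝓝 (𝓕 (fun x => (f x : ℂ)) ξ)) := by
  simp only [Real.fourier_eq]
  apply tendsto_integral_of_dominated_convergence (fun x => ‖f x‖)
  · intro n
    have := (truncFn_contDiff f hf n).continuous
    apply Continuous.aestronglyMeasurable
    apply Continuous.smul
    · have hin : Continuous fun x : V3 => -(inner ℝ x ξ) := by fun_prop
      exact continuous_induced_dom.comp (Real.continuous_fourierChar.comp hin)
    · fun_prop
  · exact hi.norm
  · intro n
    refine Eventually.of_forall fun x => ?_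
    rw [Circle.norm_smul, Complex.norm_real]
    exact truncFn_abs_le f n x
  · refine Eventually.of_forall fun x => ?_
    apply Tendsto.const_smul
    exact (Complex.continuous_ofReal.tendsto _).comp (truncFn_tendsto f x)

lemma aux_endpoint : ∃ C : ℝ≥0, ∀ f : V3 → ℝ, ContDiff ℝ (⊤ : ℕ∞) f →
    Tendsto f (Filter.cocompact V3) (nhds 0) → Integrable f →
    ∫⁻ ξ, ENNReal.ofReal (‖ξ‖ ^ (5 / 3 : ℝ)) * ‖𝓕 (fun x => (f x : ℂ)) ξ‖ₑ ^ 2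
      ≤ C * eLpNorm (fderiv ℝ (ppow f)) 2 volume ^ (8 / 3 : ℝ) := by
  obtain ⟨M, hM⟩ := thetaFn_deriv_bdd
  obtain ⟨C1, hC1⟩ := aux_A M hM
  obtain ⟨C2, hC2⟩ := aux_sob56
  refine ⟨C2 * ((M * (4 / 3)) * C1 ^ (1 / 3 : ℝ)) ^ 2, fun f hf hz hi => ?_⟩
  obtain ⟨B, hB⟩ := aux_bdd f hf.continuous hz
  have hA := hC1 f hf hz (aux_memLp f hf.continuous hi B hB (9 / 2) (by norm_num))
  set A := eLpNorm f (ENNReal.ofReal (9 / 2)) volume with hAdef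
  set D := eLpNorm (fderiv ℝ (ppow f)) 2 volume with hD
  have hA4 : A ^ (1 / 4 : ℝ) ≤ (C1 ^ (1 / 3 : ℝ) : ℝ≥0) * D ^ (1 / 3 : ℝ) := by
    calc A ^ (1 / 4 : ℝ) = (A ^ (3 / 4 : ℝ)) ^ (1 / 3 : ℝ) := by
          rw [← ENNReal.rpow_mul]; norm_num
      _ ≤ (C1 * D) ^ (1 / 3 : ℝ) := by gcongr
      _ = _ := by
          rw [ENNReal.mul_rpow_of_nonneg _ _ (by norm_num), ENNReal.coe_rpow_of_nonneg _ (by norm_num)]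
  have hDD : (D ^ (1 / 3 : ℝ) * D) ^ 2 = D ^ (8 / 3 : ℝ) := by
    have : D ^ (1 / 3 : ℝ) * D = D ^ (4 / 3 : ℝ) := by
      conv_lhs => rw [← ENNReal.rpow_one D, ← ENNReal.rpow_mul]
      rw [← ENNReal.rpow_add_of_nonneg _ _ (by norm_num) (by norm_num)]
      norm_num
    rw [this, ← ENNReal.rpow_natCast, ← ENNReal.rpow_mul]; norm_num
  apply aux_fatou (fun n ξ => ENNReal.ofReal (‖ξ‖ ^ (5 / 3 : ℝ)) *
    ‖𝓕 (fun x => (truncFn f n x : ℂ)) ξ‖ₑ ^ 2)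
  · intro n
    have hint : Integrable (fun x => (truncFn f n x : ℂ)) :=
      (Complex.continuous_ofReal.comp
        (truncFn_contDiff f hf n).continuous).integrable_of_hasCompactSupport
        ((truncFn_compact f hf.continuous hz n).comp_left (g := fun t : ℝ => (t : ℂ)) (by simp))
    have := (aux_fourier_cont _ hint).enorm.measurable
    fun_prop
  · intro ξ
    apply ENNReal.Tendsto.const_mul
    · exact ((ENNReal.continuous_pow 2).tendsto _).comp
        ((continuous_enorm.tendsto _).comp (aux_fourier_tendsto f hf hi ξ))
    · exact Or.inr ENNReal.ofReal_ne_top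
  · intro n
    refine (hC2 _ (truncFn_contDiff f hf n) (truncFn_compact f hf.continuous hz n)).trans ?_
    calc _ ≤ (C2:ℝ≥0∞) * ((M * (4 / 3) : ℝ≥0) *
            (((C1 ^ (1 / 3 : ℝ) : ℝ≥0) * D ^ (1 / 3 : ℝ)) * D)) ^ 2 := by
          gcongr
          refine (aux_grad f hf n M hM).trans ?_
          gcongr
      _ = (C2 * ((M * (4 / 3)) * C1 ^ (1 / 3 : ℝ)) ^ 2 : ℝ≥0) * (D ^ (1 / 3 : ℝ) * D) ^ 2 := by
          generalize M * (4 / 3) = a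
          generalize C1 ^ (1 / 3 : ℝ) = c
          push_cast
          ring
      _ = _ := by rw [hDD]

lemma aux_endpoint2 : ∃ C : ℝ≥0, ∀ f : V3 → ℝ, ContDiff ℝ (⊤ : ℕ∞) f →
    Tendsto f (Filter.cocompact V3) (nhds 0) → Integrable f →
    ∫⁻ ξ, ENNReal.ofReal (‖ξ‖ ^ (-1 : ℝ)) * ‖𝓕 (fun x => (f x : ℂ)) ξ‖ₑ ^ 2
      ≤ C * eLpNorm (ppow f) 2 volume ^ (8 / 3 : ℝ) := by
  obtain ⟨C, hC⟩ := aux_hls 2 (by norm_num) (by norm_num)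
  refine ⟨C, fun f hf hz hi => ?_⟩
  obtain ⟨B, hB⟩ := aux_bdd f hf.continuous hz
  have hmem : ∀ p : ℝ, 1 ≤ p → MemLp (fun x => (f x : ℂ)) (ENNReal.ofReal p) := fun p hp =>
    (aux_memLp f hf.continuous hi B hB p hp).ofReal
  have h2 := hmem 2 (by norm_num)
  rw [show ENNReal.ofReal 2 = 2 by norm_num] at h2
  have := hC (fun x => (f x : ℂ)) (Complex.continuous_ofReal.comp hf.continuous) hi.ofReal h2
    (hmem _ (by norm_num))
  have he : eLpNorm (ppow f) 2 volume = eLpNorm f (ENNReal.ofReal (3 / 2)) volume ^ (3 / 4 : ℝ) := by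
    have h1 : eLpNorm (ppow f) 2 volume = eLpNorm (fun x => ‖f x‖ ^ (3 / 4 : ℝ)) 2 volume := by
      apply eLpNorm_congr_norm_ae
      refine Eventually.of_forall fun x => ?_
      simp only [ppow, norm_mul]
      rcases lt_trichotomy (f x) 0 with h | h | h
      · rw [Real.sign_of_neg h]; simp
      · rw [h]; simp [Real.zero_rpow]
      · rw [Real.sign_of_pos h]; simp
    have h2e : (2:ℝ≥0∞) * ENNReal.ofReal (3 / 4) = ENNReal.ofReal (3 / 2) := by
      rw [show (2:ℝ≥0∞) = ENNReal.ofReal 2 by norm_num, ← ENNReal.ofReal_mul (by norm_num)]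
      norm_num
    rw [h1, eLpNorm_norm_rpow _ (by norm_num), h2e]
  have hn : eLpNorm (fun x => (f x : ℂ)) (ENNReal.ofReal (3 / 2)) volume
      = eLpNorm f (ENNReal.ofReal (3 / 2)) volume := by
    apply eLpNorm_congr_norm_ae
    exact Eventually.of_forall fun x => Complex.norm_real _
  rw [hn] at this
  rw [he, ← ENNReal.rpow_mul]
  rw [← ENNReal.rpow_natCast] at this
  norm_num at this ⊢
  exact this

/-- for smooth decaying scalar `f` on `ℝ³` and `s ∈ [−1/2, 5/6]`,
`‖f‖_{Ḣ^s} ≲ ‖f_{3/4}‖_{L²}^{5/6 − s} ‖∇ f_{3/4}‖_{L²}^{1/2 + s}`, where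
`f_{3/4} = sign(f)|f|^{3/4}`; the constant depends only on `s`. -/
theorem sobolev_power_interpolation :
    ∀ s : ℝ, -(1 / 2 : ℝ) ≤ s → s ≤ 5 / 6 →
      ∃ C : ℝ≥0, 0 < C ∧
        ∀ f : V3 → ℝ, ContDiff ℝ (⊤ : ℕ∞) f →
          Tendsto f (Filter.cocompact V3) (nhds 0) →
          sobNorm s (fun x => (f x : ℂ))
            ≤ C * (eLpNorm (ppow f) 2 volume) ^ (5 / 6 - s)
                * (eLpNorm (fderiv ℝ (ppow f)) 2 volume) ^ (1 / 2 + s) := by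
  intro s hs1 hs2
  obtain ⟨C1, hC1⟩ := aux_endpoint
  obtain ⟨C2, hC2⟩ := aux_endpoint2
  set C : ℝ≥0 := max 1 (max C1 C2) with hC
  have hCpos : 0 < C := lt_of_lt_of_le one_pos (le_max_left _ _)
  have hC1' : C1 ≤ C := (le_max_left _ _).trans (le_max_right _ _)
  have hC2' : C2 ≤ C := (le_max_right _ _).trans (le_max_right _ _)
  refine ⟨C ^ (1 / 2 : ℝ), NNReal.rpow_pos hCpos, fun f hf hz => ?_⟩
  by_cases hi : Integrable f
  swap
  · have hzero : ∀ ξ, 𝓕 (fun x => (f x : ℂ)) ξ = 0 := by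
      intro ξ
      rw [Real.fourier_eq]
      apply integral_undef
      intro hcon
      have h1 : Integrable (fun x => (f x : ℂ)) :=
        (Real.fourierIntegral_convergent_iff ξ).1 hcon
      exact hi (by simpa using h1.re)
    have : sobNorm s (fun x => (f x : ℂ)) = 0 := by
      simp [sobNorm, sobSq, hzero]
    rw [this]; exact zero_le
  set θ : ℝ := (5 / 6 - s) * (3 / 4) with hθ
  set η : ℝ := (1 / 2 + s) * (3 / 4) with hη
  have hθ0 : 0 ≤ θ := by rw [hθ]; nlinarith
  have hη0 : 0 ≤ η := by rw [hη]; nlinarith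
  have hsum : θ + η = 1 := by rw [hθ, hη]; ring
  have hY := hC1 f hf hz hi
  have hX := hC2 f hf hz hi
  set G := eLpNorm (ppow f) 2 volume with hG
  set D := eLpNorm (fderiv ℝ (ppow f)) 2 volume with hD
  have hFm : Measurable fun ξ => ‖𝓕 (fun x => (f x : ℂ)) ξ‖ₑ :=
    (aux_fourier_cont _ hi.ofReal).enorm.measurable
  have hint : sobSq s (fun x => (f x : ℂ)) ≤ (C * G ^ (8 / 3 : ℝ)) ^ θ * (C * D ^ (8 / 3 : ℝ)) ^ η := by
    calc sobSq s (fun x => (f x : ℂ))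
        = ∫⁻ ξ, (ENNReal.ofReal (‖ξ‖ ^ (-1 : ℝ)) * ‖𝓕 (fun x => (f x : ℂ)) ξ‖ₑ ^ 2) ^ θ *
          (ENNReal.ofReal (‖ξ‖ ^ (5 / 3 : ℝ)) * ‖𝓕 (fun x => (f x : ℂ)) ξ‖ₑ ^ 2) ^ η := by
          unfold sobSq
          apply lintegral_congr_ae
          have hne : ∀ᵐ ξ ∂(volume : Measure V3), ξ ≠ 0 := by
            simp [ae_iff, measure_singleton]
          filter_upwards [hne] with ξ hξ
          have hp : 0 < ‖ξ‖ := norm_pos_iff.2 hξ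
          rw [ENNReal.mul_rpow_of_nonneg _ _ hθ0, ENNReal.mul_rpow_of_nonneg _ _ hη0,
            ENNReal.ofReal_rpow_of_nonneg (by positivity) hθ0,
            ENNReal.ofReal_rpow_of_nonneg (by positivity) hη0, mul_mul_mul_comm,
            ← ENNReal.rpow_add_of_nonneg _ _ hθ0 hη0, hsum, ENNReal.rpow_one,
            ← ENNReal.ofReal_mul (by positivity), ← Real.rpow_mul hp.le, ← Real.rpow_mul hp.le,
            ← Real.rpow_add hp]
          have : 2 * s = -1 * θ + 5 / 3 * η := by rw [hθ, hη]; ring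
          rw [this]; rfl
      _ ≤ _ := ENNReal.lintegral_mul_norm_pow_le (by fun_prop) (by fun_prop) hθ0 hη0 hsum
      _ ≤ _ := by
          gcongr
          · exact hX.trans (by gcongr)
          · exact hY.trans (by gcongr)
  unfold sobNorm
  calc _ ≤ ((C * G ^ (8 / 3 : ℝ)) ^ θ * (C * D ^ (8 / 3 : ℝ)) ^ η) ^ (1 / 2 : ℝ) := by gcongr
    _ = ((C:ℝ≥0∞) ^ θ * (C:ℝ≥0∞) ^ η) ^ (1 / 2 : ℝ) * G ^ (5 / 6 - s) * D ^ (1 / 2 + s) := by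
        rw [ENNReal.mul_rpow_of_nonneg _ _ hθ0, ENNReal.mul_rpow_of_nonneg _ _ hη0,
          mul_mul_mul_comm, ENNReal.mul_rpow_of_nonneg _ _ (by norm_num),
          ENNReal.mul_rpow_of_nonneg (_ ^ θ) _ (by norm_num), mul_assoc]
        simp only [← ENNReal.rpow_mul]
        have e1 : 8 / 3 * θ * (1 / 2) = 5 / 6 - s := by rw [hθ]; ring
        have e2 : 8 / 3 * η * (1 / 2) = 1 / 2 + s := by rw [hη]; ring
        rw [ENNReal.mul_rpow_of_nonneg _ _ (by norm_num), ← ENNReal.rpow_mul, ← ENNReal.rpow_mul,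
          e1, e2]
        ring
    _ = _ := by
        rw [← ENNReal.rpow_add_of_nonneg _ _ hθ0 hη0, hsum, ENNReal.rpow_one,
          ENNReal.coe_rpow_of_nonneg _ (by norm_num)]
end
end

section
/- For a smooth scalar function f on ℝ³ decaying at infinity, ‖∇f‖_{L^{3/2}} ≲ ‖∇ f_{3/4}‖_{L²} ‖f_{3/4}‖_{L²}^{1/3} and ‖∇f‖_{L^{9/5}} ≲ ‖∇ f_{3/4}‖_{L²}^{4/3}, where f_{3/4} = sign(f)|f|^{3/4}. -/
open MeasureTheory Real FourierTransform Filter Topology ENNReal NNReal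
noncomputable section

/-- A smooth function has vanishing gradient almost everywhere on its zero set. -/
lemma ae_fderiv_eq_zero (f : V3 → ℝ) (hf : ContDiff ℝ 1 f) :
    ∀ᵐ x : V3, f x = 0 → fderiv ℝ f x = 0 := by
  have hd : Differentiable ℝ f := hf.differentiable one_ne_zero
  have hc : Continuous (fderiv ℝ f) := hf.continuous_fderiv one_ne_zero
  have key : ∀ i : Fin 3, ∀ᵐ x : V3, x ∈ {x : V3 | f x = 0 → pd i f x = 0} := by
    intro i
    have hpd : Continuous (pd i f) := by unfold pd; fun_prop
    have hms : MeasurableSet {x : V3 | f x = 0 → pd i f x = 0} := by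
      have : {x : V3 | f x = 0 → pd i f x = 0} = {x | f x = 0}ᶜ ∪ {x | pd i f x = 0} := by
        ext x; simp [imp_iff_not_or]
      rw [this]
      exact (isClosed_eq hf.continuous continuous_const).measurableSet.compl.union
        (isClosed_eq hpd continuous_const).measurableSet
    let L : ℝ →ₗ[ℝ] V3 := LinearMap.toSpanSingleton ℝ V3 (EuclideanSpace.single i 1)
    refine ae_mem_of_ae_add_linearMap_mem L volume volume hms ?_
    intro y
    let φ : ℝ → ℝ := fun t => f (y + L t)
    have hφ : ∀ t, HasDerivAt φ (pd i f (y + L t)) t := by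
      intro t
      have h1 : HasDerivAt (fun t : ℝ => y + L t) (EuclideanSpace.single i 1) t := by
        have := ((hasDerivAt_id t).smul_const (EuclideanSpace.single i (1:ℝ) : V3)).const_add y
        simpa [L] using this
      exact (hd (y + L t)).hasFDerivAt.comp_hasDerivAt t h1
    have hcount : {t : ℝ | φ t = 0 ∧ pd i f (y + L t) ≠ 0}.Countable := by
      set S := {t : ℝ | φ t = 0 ∧ pd i f (y + L t) ≠ 0} with hS
      refine (countable_setOfPred_isolated_right_within (s := S)).mono ?_
      intro t ht
      refine ⟨ht, ?_⟩
      have h2 := (hφ t).eventually_ne (c := 0) ht.2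
      have h3 : ∀ᶠ z in 𝓝[>] t, φ z ≠ 0 :=
        h2.filter_mono (nhdsWithin_mono _ (fun z hz => ne_of_gt hz))
      have h4 : ∀ᶠ z in 𝓝[S ∩ Set.Ioi t] t, φ z ≠ 0 :=
        h3.filter_mono (nhdsWithin_mono _ Set.inter_subset_right)
      rw [← Filter.eventually_false_iff_eq_bot]
      filter_upwards [h4, self_mem_nhdsWithin] with z hz hz2
      exact hz hz2.1.1
    have := hcount.ae_notMem volume
    filter_upwards [this] with t ht h0
    by_contra hne
    exact ht ⟨h0, hne⟩
  have := ae_all_iff.2 key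
  filter_upwards [this] with x hx h0
  apply ContinuousLinearMap.coe_injective
  refine (EuclideanSpace.basisFun (Fin 3) ℝ).toBasis.ext fun i => ?_
  simpa [pd] using hx i h0

/-- The signed power on reals. -/
def hpow (t : ℝ) : ℝ := Real.sign t * |t| ^ (3 / 4 : ℝ)

lemma abs_hpow (t : ℝ) : |hpow t| = |t| ^ (3 / 4 : ℝ) := by
  unfold hpow
  rcases lt_trichotomy t 0 with h | h | h
  · rw [Real.sign_of_neg h, abs_mul, abs_of_nonneg (a := |t| ^ (3 / 4 : ℝ)) (by positivity)]; simp
  · subst h; simp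
  · rw [Real.sign_of_pos h, abs_mul, abs_of_nonneg (a := |t| ^ (3 / 4 : ℝ)) (by positivity)]; simp

lemma hpow_contDiffAt {t : ℝ} (ht : t ≠ 0) : ContDiffAt ℝ 1 hpow t := by
  rcases lt_or_gt_of_ne ht with h | h
  · have : hpow =ᶠ[𝓝 t] fun s => - (-s) ^ (3 / 4 : ℝ) := by
      filter_upwards [gt_mem_nhds h] with s hs
      simp [hpow, Real.sign_of_neg hs, abs_of_neg hs]
    refine ContDiffAt.congr_of_eventuallyEq ?_ this
    exact (contDiffAt_id.neg.rpow_const_of_ne (by simpa using ht)).neg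
  · have : hpow =ᶠ[𝓝 t] fun s => s ^ (3 / 4 : ℝ) := by
      filter_upwards [lt_mem_nhds h] with s hs
      simp [hpow, Real.sign_of_pos hs, abs_of_pos hs]
    refine ContDiffAt.congr_of_eventuallyEq ?_ this
    exact contDiffAt_id.rpow_const_of_ne ht

lemma hpow_hasDerivAt {t : ℝ} (ht : t ≠ 0) :
    HasDerivAt hpow ((3 / 4) * |t| ^ (-(1 / 4) : ℝ)) t := by
  rcases lt_or_gt_of_ne ht with h | h
  · have : hpow =ᶠ[𝓝 t] fun s => - (-s) ^ (3 / 4 : ℝ) := by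
      filter_upwards [gt_mem_nhds h] with s hs
      simp [hpow, Real.sign_of_neg hs, abs_of_neg hs]
    refine HasDerivAt.congr_of_eventuallyEq ?_ this
    have := ((hasDerivAt_id t).neg.rpow_const (p := 3 / 4) (Or.inl (by simpa using ht))).neg
    convert! this using 1
    rw [abs_of_neg h]; norm_num
  · have : hpow =ᶠ[𝓝 t] fun s => s ^ (3 / 4 : ℝ) := by
      filter_upwards [lt_mem_nhds h] with s hs
      simp [hpow, Real.sign_of_pos hs, abs_of_pos hs]
    refine HasDerivAt.congr_of_eventuallyEq ?_ this
    have := ((hasDerivAt_id t).rpow_const (p := 3 / 4) (Or.inl ht))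
    convert! this using 1
    rw [abs_of_pos h]; norm_num

lemma hpow_continuous : Continuous hpow := by
  rw [continuous_iff_continuousAt]
  intro t
  by_cases ht : t = 0
  · subst ht
    have h0 : hpow 0 = 0 := by simp [hpow]
    unfold ContinuousAt
    rw [h0, tendsto_zero_iff_abs_tendsto_zero]
    have : (abs ∘ hpow) = fun t : ℝ => |t| ^ (3 / 4 : ℝ) := funext abs_hpow
    rw [this]
    have hc : Continuous fun t : ℝ => |t| ^ (3 / 4 : ℝ) :=
      continuous_abs.rpow_const (fun _ => Or.inr (by norm_num))
    simpa using hc.tendsto 0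
  · exact (hpow_contDiffAt ht).continuousAt

/-- Squared positive part. -/
def Psq (x : ℝ) : ℝ := (max x 0) ^ 2

lemma Psq_hasDerivAt (x : ℝ) : HasDerivAt Psq (2 * max x 0) x := by
  rcases lt_trichotomy x 0 with h | h | h
  · have : Psq =ᶠ[𝓝 x] fun _ => 0 := by
      filter_upwards [gt_mem_nhds h] with s hs
      simp [Psq, max_eq_right hs.le]
    rw [max_eq_right h.le]
    simpa using (hasDerivAt_const x (0:ℝ)).congr_of_eventuallyEq this
  · subst h
    rw [← hasDerivWithinAt_univ, ← Set.Iic_union_Ici (a := (0:ℝ))]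
    refine HasDerivWithinAt.union ?_ ?_
    · have := (hasDerivWithinAt_const (0:ℝ) (Set.Iic 0) (0:ℝ))
      simp only [max_self, mul_zero]
      refine this.congr ?_ ?_
      · intro y hy; simp [Psq, max_eq_right (Set.mem_Iic.1 hy)]
      · simp [Psq]
    · have := ((hasDerivAt_id (0:ℝ)).pow 2).hasDerivWithinAt (s := Set.Ici 0)
      simp only [max_self, mul_zero]
      simp at this
      refine this.congr ?_ ?_
      · intro y hy; simp [Psq, max_eq_left (Set.mem_Ici.1 hy)]
      · simp [Psq]
  · have : Psq =ᶠ[𝓝 x] fun s => s ^ 2 := by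
      filter_upwards [lt_mem_nhds h] with s hs
      simp [Psq, max_eq_left hs.le]
    rw [max_eq_left h.le]
    simpa using ((hasDerivAt_id x).pow 2).congr_of_eventuallyEq this

lemma Psq_contDiff : ContDiff ℝ 1 Psq := by
  rw [contDiff_one_iff_deriv]
  refine ⟨fun x => (Psq_hasDerivAt x).differentiableAt, ?_⟩
  have : deriv Psq = fun x => 2 * max x 0 := funext fun x => (Psq_hasDerivAt x).deriv
  rw [this]
  fun_prop

/-- The truncation. -/
def TruncFn (ε s : ℝ) : ℝ := Psq (|s| - ε) / |s|

lemma TruncFn_eq_zero {ε s : ℝ} (h : |s| ≤ ε) : TruncFn ε s = 0 := by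
  simp [TruncFn, Psq, max_eq_right (sub_nonpos.2 h)]

lemma TruncFn_contDiffAt {ε s : ℝ} (hs : s ≠ 0) : ContDiffAt ℝ 1 (TruncFn ε) s := by
  have h1 : ContDiffAt ℝ 1 (fun s : ℝ => |s|) s := contDiffAt_abs hs
  unfold TruncFn
  exact (Psq_contDiff.contDiffAt.comp s (h1.sub contDiffAt_const)).div h1 (by simpa using hs)

lemma TruncFn_deriv_le {ε s : ℝ} (hε : 0 < ε) (hs : s ≠ 0) : |deriv (TruncFn ε) s| ≤ 1 := by
  have h1 := hasDerivAt_abs hs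
  have h2 := ((Psq_hasDerivAt (|s| - ε)).comp s (h1.sub_const ε)).div h1 (by simpa using hs)
  have h3 : deriv (TruncFn ε) s = _ := h2.deriv
  rw [h3]
  have hpos : 0 < |s| := abs_pos.2 hs
  set m := max (|s| - ε) 0 with hm
  have hm0 : 0 ≤ m := le_max_right _ _
  have hm1 : m ≤ |s| := max_le (by linarith) hpos.le
  have hP : (Psq ∘ fun x => |x| - ε) s = m ^ 2 := rfl
  rw [hP]
  have h4 : (2 * m * (SignType.sign s : ℝ) * |s| - m ^ 2 * (SignType.sign s : ℝ)) / |s| ^ 2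
      = (SignType.sign s : ℝ) * ((2 * m * |s| - m ^ 2) / |s| ^ 2) := by ring
  rw [h4, abs_mul]
  have h5 : |(SignType.sign s : ℝ)| = 1 := by
    rcases lt_or_gt_of_ne hs with h | h
    · simp [sign_neg h]
    · simp [sign_pos h]
  rw [h5, one_mul, abs_of_nonneg (div_nonneg (by nlinarith) (by positivity)),
    div_le_one (by positivity)]
  nlinarith [sq_nonneg (|s| - m)]

lemma TruncFn_tendsto (s : ℝ) :
    Tendsto (fun n : ℕ => TruncFn (1 / ((n : ℝ) + 1)) s) atTop (𝓝 |s|) := by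
  have h := tendsto_one_div_add_atTop_nhds_zero_nat (𝕜 := ℝ)
  have hc : Continuous fun e : ℝ => TruncFn e s := by
    unfold TruncFn
    exact (Psq_contDiff.continuous.comp (continuous_const.sub continuous_id)).div_const _
  have h2 := (hc.tendsto 0).comp h
  have h3 : TruncFn 0 s = |s| := by
    simp only [TruncFn, Psq, sub_zero, max_eq_left (abs_nonneg s)]
    by_cases hs : s = 0
    · simp [hs]
    · have : |s| ≠ 0 := by simpa using hs
      field_simp
  rw [h3] at h2
  exact h2

lemma sobolev_ppow : ∃ K : ℝ≥0, ∀ f : V3 → ℝ, ContDiff ℝ 1 f →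
    Tendsto f (Filter.cocompact V3) (nhds 0) →
    eLpNorm (ppow f) 6 volume ≤ K * eLpNorm (fderiv ℝ (ppow f)) 2 volume := by
  refine ⟨SNormLESNormFDerivOfEqConst ℝ (volume : Measure V3) 2, fun f hf hlim => ?_⟩
  have hg : ppow f = hpow ∘ f := rfl
  have hgc : Continuous (ppow f) := hpow_continuous.comp hf.continuous
  have hglim : Tendsto (ppow f) (Filter.cocompact V3) (nhds 0) := by
    have := (hpow_continuous.tendsto 0).comp hlim
    have h0 : hpow 0 = 0 := by simp [hpow]
    rw [h0] at this
    exact this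
  have hg0 : ∀ x, f x ≠ 0 → ppow f x ≠ 0 := by
    intro x hx h
    have := abs_hpow (f x)
    have h' : hpow (f x) = 0 := h
    rw [h', abs_zero] at this
    have : 0 < |f x| ^ (3 / 4 : ℝ) := Real.rpow_pos_of_pos (abs_pos.2 hx) _
    linarith
  have hgd : ∀ x, f x ≠ 0 → ContDiffAt ℝ 1 (ppow f) x := fun x hx =>
    (hpow_contDiffAt hx).comp x hf.contDiffAt
  have hz : ∀ ε : ℝ, 0 < ε → ∀ x, f x = 0 → (TruncFn ε ∘ ppow f) =ᶠ[𝓝 x] fun _ => 0 := by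
    intro ε hε x hx
    have h0 : |ppow f x| < ε := by simp [ppow, hx, hε]
    filter_upwards [(hgc.abs.continuousAt (x := x)).eventually (gt_mem_nhds h0)] with y hy
    exact TruncFn_eq_zero hy.le
  have hu : ∀ ε : ℝ, 0 < ε → eLpNorm (TruncFn ε ∘ ppow f) 6 volume ≤
      SNormLESNormFDerivOfEqConst ℝ (volume : Measure V3) 2 *
        eLpNorm (fderiv ℝ (ppow f)) 2 volume := by
    intro ε hε
    have hC : ContDiff ℝ 1 (TruncFn ε ∘ ppow f) := by
      rw [contDiff_iff_contDiffAt]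
      intro x
      by_cases hx : f x = 0
      · exact contDiffAt_const.congr_of_eventuallyEq (hz ε hε x hx)
      · exact (TruncFn_contDiffAt (hg0 x hx)).comp x (hgd x hx)
    have hK : HasCompactSupport (TruncFn ε ∘ ppow f) := by
      have h1 : {x | |ppow f x| < ε} ∈ Filter.cocompact V3 := by
        have := hglim.abs
        rw [abs_zero] at this
        exact this.eventually (gt_mem_nhds hε)
      obtain ⟨K, hK, hKs⟩ := Filter.mem_cocompact.1 h1
      refine HasCompactSupport.intro hK fun x hx => ?_
      have h2 : |ppow f x| < ε := hKs hx
      exact TruncFn_eq_zero h2.le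
    have hS := eLpNorm_le_eLpNorm_fderiv_of_eq (F := ℝ) (volume : Measure V3) hC hK
      (p := 2) (p' := 6) (by norm_num) (by simp) (by simp; norm_num)
    refine (le_trans (by simpa using hS) ?_)
    gcongr
    refine eLpNorm_mono fun x => ?_
    by_cases hx : f x = 0
    · rw [(hz ε hε x hx).fderiv_eq]; simp
    · have hT := ((TruncFn_contDiffAt (ε := ε) (hg0 x hx)).differentiableAt one_ne_zero).hasDerivAt
      have hD := ((hgd x hx).differentiableAt one_ne_zero).hasFDerivAt
      have := hT.comp_hasFDerivAt x hD
      rw [this.fderiv, norm_smul]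
      exact mul_le_of_le_one_left (norm_nonneg _) (TruncFn_deriv_le hε (hg0 x hx))
  have hmeas : ∀ n : ℕ, AEStronglyMeasurable
      ((fun (n : ℕ) => TruncFn (1 / ((n : ℝ) + 1)) ∘ ppow f) n) (volume : Measure V3) := by
    intro n
    have : Measurable (TruncFn (1 / ((n : ℝ) + 1))) := by
      unfold TruncFn
      have := Psq_contDiff.continuous.measurable
      fun_prop
    exact (this.comp hgc.measurable).aestronglyMeasurable
  have hfatou := Lp.eLpNorm_lim_le_liminf_eLpNorm (p := 6) hmeas (fun x => |ppow f x|)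
    (Eventually.of_forall fun x => TruncFn_tendsto (ppow f x))
  have he : eLpNorm (fun x => |ppow f x|) 6 volume = eLpNorm (ppow f) 6 volume :=
    eLpNorm_norm (ppow f)
  rw [he] at hfatou
  refine hfatou.trans ?_
  refine liminf_le_of_frequently_le' (Eventually.frequently (Eventually.of_forall fun n => ?_))
  exact hu _ (by positivity)

lemma pointwise_bound (f : V3 → ℝ) (hf : ContDiff ℝ 1 f) :
    ∀ᵐ x : V3, ‖fderiv ℝ f x‖ ≤
      (4 / 3) * ‖(‖ppow f x‖ ^ (1 / 3 : ℝ)) • fderiv ℝ (ppow f) x‖ := by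
  filter_upwards [ae_fderiv_eq_zero f hf] with x hx
  by_cases h0 : f x = 0
  · rw [hx h0]; simp
  · have hD := (hpow_hasDerivAt h0).comp_hasFDerivAt x
      (hf.differentiable one_ne_zero x).hasFDerivAt
    have hD' : HasFDerivAt (ppow f) _ x := hD
    have ha : ‖ppow f x‖ = |f x| ^ (3 / 4 : ℝ) := abs_hpow (f x)
    have hp : 0 < |f x| := abs_pos.2 h0
    rw [hD'.fderiv, ha, ← Real.rpow_mul hp.le, smul_smul, norm_smul, Real.norm_eq_abs]
    have : |f x| ^ (3 / 4 * (1 / 3) : ℝ) * (3 / 4 * |f x| ^ (-(1 / 4) : ℝ)) = 3 / 4 := by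
      rw [mul_left_comm, ← Real.rpow_add hp]; norm_num
    rw [this, abs_of_pos (by norm_num)]
    apply le_of_eq; ring

lemma holder_bound (f : V3 → ℝ) (hf : ContDiff ℝ 1 f) (p q r : ℝ≥0∞)
    [hpq : ENNReal.HolderTriple q 2 p] (hr : q * ENNReal.ofReal (1 / 3) = r) :
    eLpNorm (fderiv ℝ f) p volume ≤ ENNReal.ofReal (4 / 3) *
      (eLpNorm (ppow f) r volume ^ (1 / 3 : ℝ) * eLpNorm (fderiv ℝ (ppow f)) 2 volume) := by
  have hgc : Continuous (ppow f) := hpow_continuous.comp hf.continuous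
  refine (eLpNorm_le_mul_eLpNorm_of_ae_le_mul (pointwise_bound f hf) p).trans ?_
  gcongr
  have h := eLpNorm_smul_le_mul_eLpNorm (p := q) (q := 2) (r := p) (μ := (volume : Measure V3))
    (f := fderiv ℝ (ppow f)) (φ := fun x => ‖ppow f x‖ ^ (1 / 3 : ℝ))
    (measurable_fderiv ℝ (ppow f)).aestronglyMeasurable
    (hgc.norm.rpow_const (fun _ => Or.inr (by norm_num))).aestronglyMeasurable
  rw [eLpNorm_norm_rpow _ (by norm_num), hr] at h
  exact h

/-- for a smooth decaying scalar `f` on `ℝ³`,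
`‖∇f‖_{L^{3/2}} ≲ ‖∇ f_{3/4}‖_{L²} ‖f_{3/4}‖_{L²}^{1/3}` and
`‖∇f‖_{L^{9/5}} ≲ ‖∇ f_{3/4}‖_{L²}^{4/3}`, with absolute constants. -/
theorem gradient_power_estimates :
    ∃ C : ℝ≥0, 0 < C ∧
      ∀ f : V3 → ℝ, ContDiff ℝ (⊤ : ℕ∞) f →
        Tendsto f (Filter.cocompact V3) (nhds 0) →
        eLpNorm (fderiv ℝ f) (3 / 2 : ℝ≥0∞) volume
            ≤ C * eLpNorm (fderiv ℝ (ppow f)) 2 volume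
                * (eLpNorm (ppow f) 2 volume) ^ (1 / 3 : ℝ)
        ∧ eLpNorm (fderiv ℝ f) (9 / 5 : ℝ≥0∞) volume
            ≤ C * (eLpNorm (fderiv ℝ (ppow f)) 2 volume) ^ (4 / 3 : ℝ) := by

  obtain ⟨K, hK⟩ := sobolev_ppow
  refine ⟨(4 / 3) * (K ^ (1 / 3 : ℝ) + 1), by positivity, fun f hf hlim => ?_⟩
  have hf1 : ContDiff ℝ 1 f := hf.of_le (by exact_mod_cast le_top)
  have hofr : ENNReal.ofReal (4 / 3) = ((4 / 3 : ℝ≥0) : ℝ≥0∞) := by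
    rw [ENNReal.ofReal]
    congr 1
    ext
    rw [Real.coe_toNNReal _ (by norm_num)]
    norm_num
  have hC : ENNReal.ofReal (4 / 3) ≤ (((4 / 3) * (K ^ (1 / 3 : ℝ) + 1) : ℝ≥0) : ℝ≥0∞) := by
    rw [hofr]
    norm_cast
    exact le_mul_of_one_le_right' (by simp)
  constructor
  · have : ENNReal.HolderTriple 6 2 (3 / 2 : ℝ≥0∞) := ⟨by
      rw [← ENNReal.toReal_eq_toReal_iff' (by finiteness)
        (ENNReal.inv_ne_top.2 (ENNReal.div_ne_zero.2 ⟨by norm_num, by finiteness⟩)), ENNReal.toReal_add (by finiteness) (by finiteness)]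
      norm_num⟩
    have h := holder_bound f hf1 (3 / 2) 6 2 (by
      rw [← ENNReal.toReal_eq_toReal_iff' (by finiteness) (by finiteness), ENNReal.toReal_mul,
        ENNReal.toReal_ofReal (by norm_num)]
      norm_num)
    refine h.trans ?_
    rw [mul_assoc, mul_comm (eLpNorm (ppow f) 2 volume ^ (1 / 3 : ℝ))]
    gcongr
  · have : ENNReal.HolderTriple 18 2 (9 / 5 : ℝ≥0∞) := ⟨by
      rw [← ENNReal.toReal_eq_toReal_iff' (by finiteness)
        (ENNReal.inv_ne_top.2 (ENNReal.div_ne_zero.2 ⟨by norm_num, by finiteness⟩)), ENNReal.toReal_add (by finiteness) (by finiteness)]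
      norm_num⟩
    have h := holder_bound f hf1 (9 / 5) 18 6 (by
      rw [← ENNReal.toReal_eq_toReal_iff' (by finiteness) (by finiteness), ENNReal.toReal_mul,
        ENNReal.toReal_ofReal (by norm_num)]
      norm_num)
    refine h.trans ?_
    have h6 := hK f hf1 hlim
    set A := eLpNorm (fderiv ℝ (ppow f)) 2 volume
    calc ENNReal.ofReal (4 / 3) * (eLpNorm (ppow f) 6 volume ^ (1 / 3 : ℝ) * A)
        ≤ ENNReal.ofReal (4 / 3) * ((K * A) ^ (1 / 3 : ℝ) * A) := by gcongr
      _ = (ENNReal.ofReal (4 / 3) * (K : ℝ≥0∞) ^ (1 / 3 : ℝ)) * A ^ (4 / 3 : ℝ) := by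
          rw [ENNReal.mul_rpow_of_nonneg _ _ (by norm_num)]
          have : A ^ (4 / 3 : ℝ) = A ^ (1 / 3 : ℝ) * A := by
            rw [show (4 / 3 : ℝ) = 1 / 3 + 1 by norm_num,
              ENNReal.rpow_add_of_nonneg _ _ (by norm_num) (by norm_num), ENNReal.rpow_one]
          rw [this]; ring
      _ ≤ _ := by
          gcongr
          rw [hofr, ← ENNReal.coe_rpow_of_nonneg _ (by norm_num)]
          norm_cast
          gcongr
          simp
end
end
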